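/- Let 𝒰 be an open subset of Ω and δ > 0 be such that 𝒰_δ = {x ∈ ℝ² : dist(x,𝒰) ≤ δ} is contained in Ω, and set 𝒱_δ = 𝒰_δ \ 𝒰. If ν_⋆(𝒱_δ) = 0, then ν_⋆(closure of 𝒰) = 0. -/

import Mathlib

open MeasureTheory Metric Filter Topology Bornology
open scoped RealInnerProductSpace ENNReal Topology

noncomputable section

/-- The euclidean plane. -/
abbrev E2 : Type := EuclideanSpace ℝ (Fin 2)

/-- The euclidean space `ℝ^k`. -/
abbrev Evec (k : ℕ) : Type := EuclideanSpace ℝ (Fin k)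

/-- The `i`-th standard basis vector of the plane. -/
def b2 (i : Fin 2) : E2 := EuclideanSpace.single i (1 : ℝ)

/-- The partial derivative of `u` in the `i`-th coordinate direction. -/
def pder {k : ℕ} (u : E2 → Evec k) (i : Fin 2) (x : E2) : Evec k :=
  fderiv ℝ u x (b2 i)

/-- The Laplacian of a map defined on the plane. -/
def lap {k : ℕ} (u : E2 → Evec k) (x : E2) : Evec k :=
  ∑ i : Fin 2, fderiv ℝ (pder u i) x (b2 i)

/-- `u` is a smooth solution of the vectorial Allen-Cahn system
`Δu = ε⁻² ∇V(u)` on the open set `U`. -/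
def IsSolution {k : ℕ} (V : Evec k → ℝ) (ε : ℝ) (U : Set E2) (u : E2 → Evec k) : Prop :=
  ContDiffOn ℝ (⊤ : ℕ∞) u U ∧ ∀ x ∈ U, lap u x = (ε ^ 2)⁻¹ • gradient V (u x)

/-- The squared modulus `|∇u|²` of the full gradient. -/
def gradSq {k : ℕ} (u : E2 → Evec k) (x : E2) : ℝ :=
  ∑ i : Fin 2, ‖pder u i x‖ ^ 2

/-- The energy density `e_ε(u) = (ε/2)|∇u|² + ε⁻¹ V(u)`. -/
def eDens {k : ℕ} (V : Evec k → ℝ) (ε : ℝ) (u : E2 → Evec k) (x : E2) : ℝ :=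
  ε / 2 * gradSq u x + ε⁻¹ * V (u x)

/-- The energy `E_ε(u, G)`. -/
def energy {k : ℕ} (V : Evec k → ℝ) (ε : ℝ) (u : E2 → Evec k) (G : Set E2) : ℝ :=
  ∫ x in G, eDens V ε u x

/-- The hypotheses (H₁), (H₂), (H₃) on the multi-well potential `V`:
smooth, nonnegative with `inf V = 0`, finitely many zeros (at least two),
positive definite Hessian at each zero, quadratic growth of `y·∇V(y)` at
infinity and coercivity. -/
structure IsMultiWell {k : ℕ} (V : Evec k → ℝ) : Prop where
  smooth : ContDiff ℝ (⊤ : ℕ∞) V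
  nonneg : ∀ y, 0 ≤ V y
  finite_zeros : {y : Evec k | V y = 0}.Finite
  two_le_card : 2 ≤ {y : Evec k | V y = 0}.ncard
  hess_posdef : ∀ σ : Evec k, V σ = 0 → ∀ w : Evec k, w ≠ 0 →
    0 < iteratedFDeriv ℝ 2 V σ ![w, w]
  growth : ∃ α > (0 : ℝ), ∃ R > (0 : ℝ), ∀ y : Evec k, R < ‖y‖ →
    α * ‖y‖ ^ 2 ≤ ⟪y, gradient V y⟫
  coercive : ∀ C : ℝ, ∃ R : ℝ, ∀ y : Evec k, R ≤ ‖y‖ → C ≤ V y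

/-- A continuous test function compactly supported in `Ω`. -/
def TestFun (Ω : Set E2) (f : E2 → ℝ) : Prop :=
  Continuous f ∧ HasCompactSupport f ∧ tsupport f ⊆ Ω

/-- The lower one-dimensional density of the measure `ν` at `x`. -/
def densLow (ν : Measure E2) (x : E2) : ℝ :=
  Filter.liminf (fun r : ℝ => (ν (closedBall x r)).toReal / r) (𝓝[>] 0)

/-- The concentration set `𝔖⋆ = {x ∈ Ω | liminf_{r→0} ν(D̄(x,r))/r ≥ η}`. -/
def concSet (ν : Measure E2) (Ω : Set E2) (η : ℝ) : Set E2 :=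
  {x ∈ Ω | η ≤ densLow ν x}

open scoped ContDiff

section PartialDerivatives

variable {F G : Type*} [NormedAddCommGroup F] [NormedSpace ℝ F]
  [NormedAddCommGroup G] [NormedSpace ℝ G]

/-- The partial derivative of a map on the plane with values in any normed space. -/
def partialD (i : Fin 2) (f : E2 → F) (x : E2) : F := fderiv ℝ f x (b2 i)

lemma ContDiff.partialD {f : E2 → F} (hf : ContDiff ℝ ∞ f) (i : Fin 2) :
    ContDiff ℝ ∞ (partialD i f) := by
  unfold _root_.partialD
  exact (hf.fderiv_right (m := ∞) (by simp)).clm_apply contDiff_const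

lemma ContDiff.differentiable_infty {f : E2 → F} (hf : ContDiff ℝ ∞ f) : Differentiable ℝ f :=
  hf.differentiable (by simp)

lemma partialD_comm {f : E2 → F} (hf : ContDiff ℝ ∞ f) (i j : Fin 2) :
    partialD i (partialD j f) = partialD j (partialD i f) := by
  have key (i j : Fin 2) (x : E2) :
      partialD i (partialD j f) x = fderiv ℝ (fderiv ℝ f) x (b2 i) (b2 j) := by
    unfold partialD
    rw [fderiv_clm_apply]
    · simp
    · exact ((hf.fderiv_right (m := ∞) (by simp)).differentiable (by simp)).differentiableAt
    · fun_prop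
  ext1 x
  rw [key, key]
  exact (hf.contDiffAt.isSymmSndFDerivAt
    (by
      simp only [minSmoothness_of_isRCLikeNormedField]
      exact WithTop.coe_le_coe.2 (le_top : (2 : ℕ∞) ≤ ⊤))).eq _ _

lemma partialD_mul {f g : E2 → ℝ} (hf : ContDiff ℝ ∞ f) (hg : ContDiff ℝ ∞ g)
    (i : Fin 2) (x : E2) :
    partialD i (fun y => f y * g y) x = f x * partialD i g x + partialD i f x * g x := by
  unfold partialD
  rw [fderiv_fun_mul hf.differentiable_infty.differentiableAt
    hg.differentiable_infty.differentiableAt]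
  simp [mul_comm]

lemma partialD_const_mul {f : E2 → ℝ} (hf : ContDiff ℝ ∞ f) (c : ℝ) (i : Fin 2) (x : E2) :
    partialD i (fun y => c * f y) x = c * partialD i f x := by
  unfold partialD
  rw [fderiv_const_mul hf.differentiable_infty.differentiableAt]
  simp

lemma partialD_add {f g : E2 → F} (hf : ContDiff ℝ ∞ f) (hg : ContDiff ℝ ∞ g)
    (i : Fin 2) (x : E2) :
    partialD i (fun y => f y + g y) x = partialD i f x + partialD i g x := by
  unfold partialD
  rw [fderiv_fun_add hf.differentiable_infty.differentiableAt
    hg.differentiable_infty.differentiableAt]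
  simp

lemma partialD_sub {f g : E2 → F} (hf : ContDiff ℝ ∞ f) (hg : ContDiff ℝ ∞ g)
    (i : Fin 2) (x : E2) :
    partialD i (fun y => f y - g y) x = partialD i f x - partialD i g x := by
  unfold partialD
  rw [fderiv_fun_sub hf.differentiable_infty.differentiableAt
    hg.differentiable_infty.differentiableAt]
  simp

lemma partialD_inner {F : Type*} [NormedAddCommGroup F] [InnerProductSpace ℝ F] {f g : E2 → F}
    (hf : ContDiff ℝ ∞ f) (hg : ContDiff ℝ ∞ g) (i : Fin 2) (x : E2) :
    partialD i (fun y => ⟪f y, g y⟫) x = ⟪f x, partialD i g x⟫ + ⟪partialD i f x, g x⟫ := by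
  unfold partialD
  rw [fderiv_inner_apply ℝ hf.differentiable_infty.differentiableAt
    hg.differentiable_infty.differentiableAt]

lemma partialD_comp {f : E2 → F} {g : F → G} (hf : ContDiff ℝ ∞ f) (hg : ContDiff ℝ ∞ g)
    (i : Fin 2) (x : E2) :
    partialD i (fun y => g (f y)) x = fderiv ℝ g (f x) (partialD i f x) := by
  unfold partialD
  have := fderiv_comp (𝕜 := ℝ) (g := g) (f := f) x (hg.differentiable (by simp)).differentiableAt
    hf.differentiable_infty.differentiableAt
  change fderiv ℝ (g ∘ f) x _ = _
  rw [this]; rfl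

lemma partialD_comp_real {f : E2 → ℝ} {g : ℝ → ℝ} (hf : ContDiff ℝ ∞ f) (hg : ContDiff ℝ ∞ g)
    (i : Fin 2) (x : E2) :
    partialD i (fun y => g (f y)) x = deriv g (f x) * partialD i f x := by
  rw [partialD_comp hf hg, fderiv_eq_smul_deriv, smul_eq_mul, mul_comm]

lemma partialD_comp_affine {f : E2 → F} (hf : ContDiff ℝ ∞ f) (x₀ : E2) (s : ℝ)
    (i : Fin 2) (x : E2) :
    partialD i (fun y => f (x₀ + s • y)) x = s • partialD i f (x₀ + s • x) := by
  rw [partialD_comp (F := E2) (f := fun y => x₀ + s • y) (by fun_prop) hf]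
  unfold partialD
  have h : HasFDerivAt (fun y : E2 => x₀ + s • y) (s • ContinuousLinearMap.id ℝ E2) x :=
    ((hasFDerivAt_id x).const_smul s).const_add x₀
  rw [h.fderiv]
  simp

lemma partialD_congr {f g : E2 → F} {x : E2} (h : f =ᶠ[𝓝 x] g) (i : Fin 2) :
    partialD i f =ᶠ[𝓝 x] partialD i g := by
  filter_upwards [h.fderiv (𝕜 := ℝ)] with y hy
  simp [partialD, hy]

lemma partialD_eq_zero_of_notMem_tsupport {f : E2 → F} {x : E2} (hx : x ∉ tsupport f)
    (i : Fin 2) : partialD i f x = 0 := by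
  have h : f =ᶠ[𝓝 x] fun _ => 0 := notMem_tsupport_iff_eventuallyEq.1 hx
  rw [(partialD_congr h i).eq_of_nhds]
  simp [partialD]

lemma HasCompactSupport.partialD {f : E2 → F} (hf : HasCompactSupport f) (i : Fin 2) :
    HasCompactSupport (partialD i f) :=
  hf.mono' fun _ hx => by_contra fun h => hx (partialD_eq_zero_of_notMem_tsupport h i)

/-- The integral of a partial derivative of a compactly supported smooth function vanishes. -/
lemma integral_partialD_eq_zero {f : E2 → ℝ} (hf : ContDiff ℝ ∞ f) (hc : HasCompactSupport f)
    (i : Fin 2) : ∫ x, partialD i f x = 0 := by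
  have hI : Integrable f := hf.continuous.integrable_of_hasCompactSupport hc
  have hI' : Integrable (partialD i f) :=
    (hf.partialD i).continuous.integrable_of_hasCompactSupport (hc.partialD i)
  have := integral_mul_fderiv_eq_neg_fderiv_mul_of_integrable (μ := (volume : Measure E2))
    (f := fun _ => (1 : ℝ)) (g := f) (v := b2 i) (by simp) (by simpa using! hI') (by simpa using hI)
    (fun x _ => by fun_prop) (fun x _ => hf.differentiable_infty.differentiableAt)
  simpa [partialD] using this

/-- The divergence theorem for compactly supported smooth vector fields. -/
lemma integral_div_eq_zero {f : Fin 2 → E2 → ℝ} (hf : ∀ i, ContDiff ℝ ∞ (f i))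
    (hc : ∀ i, HasCompactSupport (f i)) : ∫ x, ∑ i, partialD i (f i) x = 0 := by
  rw [integral_finsetSum]
  · simp [integral_partialD_eq_zero (hf _) (hc _)]
  · exact fun i _ => ((hf i).partialD i).continuous.integrable_of_hasCompactSupport
      ((hc i).partialD i)

/-- The Laplacian of a map on the plane with values in any normed space. -/
def laplacian2 (f : E2 → F) (x : E2) : F := ∑ i, partialD i (partialD i f) x

lemma laplacian2_eq_zero_of_notMem_tsupport {f : E2 → F} {x : E2} (hx : x ∉ tsupport f) :
    laplacian2 f x = 0 := by
  refine Finset.sum_eq_zero fun i _ => partialD_eq_zero_of_notMem_tsupport ?_ i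
  refine notMem_tsupport_iff_eventuallyEq.2 ?_
  filter_upwards [(isClosed_tsupport f).isOpen_compl.mem_nhds hx] with y hy
  exact partialD_eq_zero_of_notMem_tsupport hy i

lemma ContDiff.laplacian2 {f : E2 → F} (hf : ContDiff ℝ ∞ f) : ContDiff ℝ ∞ (laplacian2 f) :=
  ContDiff.sum fun i _ => (hf.partialD i).partialD i

lemma lap_eq_laplacian2 {k : ℕ} (u : E2 → Evec k) : lap u = laplacian2 u := rfl

lemma pder_eq_partialD {k : ℕ} (u : E2 → Evec k) (i : Fin 2) : pder u i = partialD i u := rfl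

lemma sum_smul_b2 (y : E2) : ∑ i, y i • b2 i = y := by
  ext j
  fin_cases j <;> simp [b2]

lemma fderiv_eq_sum_partialD (f : E2 → F) (x y : E2) :
    fderiv ℝ f x y = ∑ i, y i • partialD i f x := by
  conv_lhs => rw [← sum_smul_b2 y]
  simp [partialD]

end PartialDerivatives

section MeanValue

/-- A smooth radial bump on the plane, supported in the unit disk. -/
def radialBump (y : E2) : ℝ := expNegInvGlue (1 - ‖y‖ ^ 2)

/-- The radial density `ρ` with `∇Q(y) = -ρ(y) y`, where `Q` is `radialBump`. -/
def radialDensity (y : E2) : ℝ := 2 * deriv expNegInvGlue (1 - ‖y‖ ^ 2)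

lemma contDiff_expNegInvGlue : ContDiff ℝ ∞ expNegInvGlue := expNegInvGlue.contDiff

lemma contDiff_radialBump : ContDiff ℝ ∞ radialBump :=
  contDiff_expNegInvGlue.comp (contDiff_const.sub (contDiff_norm_sq ℝ))

lemma contDiff_radialDensity : ContDiff ℝ ∞ radialDensity :=
  contDiff_const.mul ((contDiff_infty_iff_deriv.1 contDiff_expNegInvGlue).2.comp
    (contDiff_const.sub (contDiff_norm_sq ℝ)))

lemma radialBump_nonneg (y : E2) : 0 ≤ radialBump y := expNegInvGlue.nonneg _

lemma radialDensity_nonneg (y : E2) : 0 ≤ radialDensity y :=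
  mul_nonneg zero_le_two expNegInvGlue.monotone.deriv_nonneg

lemma radialBump_eq_zero {y : E2} (hy : 1 ≤ ‖y‖) : radialBump y = 0 :=
  expNegInvGlue.zero_of_nonpos (by nlinarith)

lemma radialDensity_eq_zero {y : E2} (hy : 1 < ‖y‖) : radialDensity y = 0 := by
  have h : expNegInvGlue =ᶠ[𝓝 (1 - ‖y‖ ^ 2)] fun _ => 0 := by
    filter_upwards [Iio_mem_nhds (show 1 - ‖y‖ ^ 2 < 0 by nlinarith)] with t ht
    exact expNegInvGlue.zero_of_nonpos (le_of_lt ht)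
  simp [radialDensity, h.deriv_eq]

lemma hasCompactSupport_radialBump : HasCompactSupport radialBump :=
  HasCompactSupport.intro (isCompact_closedBall (0 : E2) 1) fun y hy =>
    radialBump_eq_zero (by simpa using (not_le.1 (by simpa using hy) : 1 < ‖y‖).le)

lemma hasCompactSupport_radialDensity : HasCompactSupport radialDensity :=
  HasCompactSupport.intro (isCompact_closedBall (0 : E2) 1) fun y hy =>
    radialDensity_eq_zero (by simpa using hy)

lemma partialD_radialBump (i : Fin 2) (y : E2) :
    partialD i radialBump y = -(y i * radialDensity y) := by
  have h1 : HasFDerivAt (fun y : E2 => 1 - ‖y‖ ^ 2) (-(2 • innerSL ℝ y)) y := by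
    simpa using ((hasFDerivAt_id y).norm_sq).const_sub 1
  have h2 : HasDerivAt expNegInvGlue (deriv expNegInvGlue (1 - ‖y‖ ^ 2)) (1 - ‖y‖ ^ 2) :=
    (contDiff_expNegInvGlue.differentiable (by simp)).differentiableAt.hasDerivAt
  have h3 := h2.comp_hasFDerivAt y h1
  have h4 : fderiv ℝ radialBump y = _ := h3.fderiv
  simp only [partialD, h4, radialDensity, b2]
  simp [EuclideanSpace.inner_single_right]
  ring

lemma integral_radialDensity_pos : 0 < ∫ y, radialDensity y := by
  obtain ⟨y, hy⟩ : ∃ y, radialDensity y ≠ 0 := by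
    by_contra! h
    have h0 : ∀ y, fderiv ℝ radialBump y = 0 := fun y => by
      ext v
      rw [fderiv_eq_sum_partialD]
      simp [partialD_radialBump, h]
    have h1 : radialBump 0 = radialBump (b2 0) :=
      is_const_of_fderiv_eq_zero (𝕜 := ℝ) contDiff_radialBump.differentiable_infty h0 _ _
    rw [radialBump_eq_zero (y := b2 0) (by simp [b2])] at h1
    have : 0 < radialBump 0 := expNegInvGlue.pos_of_pos (by simp)
    linarith
  exact contDiff_radialDensity.continuous.integral_pos_of_hasCompactSupport_nonneg_nonzero
    hasCompactSupport_radialDensity radialDensity_nonneg hy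

lemma hasDerivAt_integral_comp_affine {f ρ : E2 → ℝ} (hf : ContDiff ℝ ∞ f) (hρ : Continuous ρ)
    (hρc : HasCompactSupport ρ) (x₀ : E2) (s : ℝ) :
    HasDerivAt (fun s : ℝ => ∫ y, f (x₀ + s • y) * ρ y)
      (∫ y, fderiv ℝ f (x₀ + s • y) y * ρ y) s := by
  have hf' : Continuous (fderiv ℝ f) := hf.continuous_fderiv (by simp)
  have hg : Continuous fun p : ℝ × E2 => fderiv ℝ f (x₀ + p.1 • p.2) p.2 * ρ p.2 := by fun_prop
  obtain ⟨C, hC⟩ := ((isCompact_Icc (a := s - 1) (b := s + 1)).prod hρc).exists_bound_of_continuousOn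
    hg.continuousOn
  have hb : ∀ y : E2, ∀ t ∈ Set.Icc (s - 1) (s + 1),
      ‖fderiv ℝ f (x₀ + t • y) y * ρ y‖ ≤ (tsupport ρ).indicator (fun _ => C) y := by
    intro y t ht
    by_cases hy : y ∈ tsupport ρ
    · rw [Set.indicator_of_mem hy]
      exact hC (t, y) ⟨ht, hy⟩
    · rw [Set.indicator_of_notMem hy, image_eq_zero_of_notMem_tsupport hy]
      simp
  refine (hasDerivAt_integral_of_dominated_loc_of_deriv_le
    (F := fun s y => f (x₀ + s • y) * ρ y)
    (F' := fun s y => fderiv ℝ f (x₀ + s • y) y * ρ y)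
    (Icc_mem_nhds (show s - 1 < s by linarith) (show s < s + 1 by linarith))
    (Eventually.of_forall fun t => ?_) ?_ ?_ (Eventually.of_forall hb) ?_
    (Eventually.of_forall fun y t _ => ?_)).2
  · have := hf.continuous
    exact Continuous.aestronglyMeasurable (by fun_prop)
  · have := hf.continuous
    exact Continuous.integrable_of_hasCompactSupport (by fun_prop) hρc.mul_left
  · exact Continuous.aestronglyMeasurable (by fun_prop)
  · exact (integrable_indicator_iff hρc.isCompact.measurableSet).2
      (integrableOn_const hρc.isCompact.measure_lt_top.ne)
  · have h1 : HasDerivAt (fun t : ℝ => x₀ + t • y) y t := by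
      simpa using ((hasDerivAt_id t).smul_const y).const_add x₀
    exact (((hf.differentiable_infty (x₀ + t • y)).hasFDerivAt).comp_hasDerivAt t h1).mul_const _

/-- The derivative of a radial average is a weighted average of the Laplacian. -/
lemma hasDerivAt_radial_average {f : E2 → ℝ} (hf : ContDiff ℝ ∞ f) (x₀ : E2) (s : ℝ) :
    HasDerivAt (fun s : ℝ => ∫ y, f (x₀ + s • y) * radialDensity y)
      (s * ∫ y, laplacian2 f (x₀ + s • y) * radialBump y) s := by
  convert hasDerivAt_integral_comp_affine hf contDiff_radialDensity.continuous
    hasCompactSupport_radialDensity x₀ s using 1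
  have hp : ∀ i, ContDiff ℝ ∞ (partialD i f) := hf.partialD
  have hp' : ∀ i, ContDiff ℝ ∞ fun y => partialD i f (x₀ + s • y) := fun i =>
    (hp i).comp (by fun_prop)
  have hQ := contDiff_radialBump
  have h := integral_div_eq_zero
    (f := fun i y => partialD i f (x₀ + s • y) * radialBump y)
    (fun i => (hp' i).mul hQ) (fun i => hasCompactSupport_radialBump.mul_left)
  have hI1 : Integrable fun y => s * (laplacian2 f (x₀ + s • y) * radialBump y) := by
    have := hf.laplacian2.continuous
    have := hQ.continuous
    exact Continuous.integrable_of_hasCompactSupport (by fun_prop)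
      (hasCompactSupport_radialBump.mul_left).mul_left
  have hI2 : Integrable fun y => fderiv ℝ f (x₀ + s • y) y * radialDensity y := by
    have := hf.continuous_fderiv (by simp)
    have := contDiff_radialDensity.continuous
    exact Continuous.integrable_of_hasCompactSupport (by fun_prop)
      hasCompactSupport_radialDensity.mul_left
  rw [← integral_const_mul, ← sub_eq_zero, ← integral_sub hI1 hI2, ← h]
  congr 1
  ext y
  rw [fderiv_eq_sum_partialD]
  simp only [partialD_mul (hp' _) hQ, partialD_comp_affine (hp _), partialD_radialBump,
    laplacian2, Fin.sum_univ_two, smul_eq_mul]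
  ring

lemma add_smul_mem_closedBall {x₀ y : E2} {s r : ℝ} (hs : s ∈ Set.Icc 0 r)
    (hy : ‖y‖ ≤ 1) : x₀ + s • y ∈ closedBall x₀ r := by
  rw [mem_closedBall, dist_eq_norm, add_sub_cancel_left, norm_smul, Real.norm_of_nonneg hs.1]
  nlinarith [hs.1, hs.2, norm_nonneg y]

/-- Mean value inequality for smooth functions that are subharmonic on a disk. -/
lemma le_radial_average_of_laplacian_nonneg {f : E2 → ℝ} (hf : ContDiff ℝ ∞ f) (x₀ : E2)
    {r : ℝ} (hr : 0 ≤ r) (hsub : ∀ x ∈ closedBall x₀ r, 0 ≤ laplacian2 f x) :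
    (∫ y, radialDensity y) * f x₀ ≤ ∫ y, f (x₀ + r • y) * radialDensity y := by
  have hm : MonotoneOn (fun s : ℝ => ∫ y, f (x₀ + s • y) * radialDensity y) (Set.Icc 0 r) := by
    refine monotoneOn_of_hasDerivWithinAt_nonneg (convex_Icc 0 r)
      (fun s _ => (hasDerivAt_radial_average hf x₀ s).continuousAt.continuousWithinAt)
      (fun s _ => (hasDerivAt_radial_average hf x₀ s).hasDerivWithinAt) fun s hs => ?_
    rw [interior_Icc] at hs
    refine mul_nonneg hs.1.le (integral_nonneg fun y => ?_)
    rcases le_total 1 ‖y‖ with hy | hy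
    · simp [radialBump_eq_zero hy]
    · exact mul_nonneg (hsub _ (add_smul_mem_closedBall (Set.Ioo_subset_Icc_self hs) hy))
        (radialBump_nonneg y)
  have := hm (Set.left_mem_Icc.2 hr) (Set.right_mem_Icc.2 hr) hr
  simpa [integral_const_mul, mul_comm] using this

/-- Interior gradient estimate for smooth functions with bounded Laplacian. -/
lemma exists_interior_gradient_estimate : ∃ C : ℝ, 0 ≤ C ∧ ∀ (f : E2 → ℝ) (_ : ContDiff ℝ ∞ f)
    (x₀ : E2) (r A B : ℝ) (_ : 0 < r) (_ : ∀ x ∈ closedBall x₀ r, |f x| ≤ B)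
    (_ : ∀ x ∈ closedBall x₀ r, |laplacian2 f x| ≤ A) (i : Fin 2),
    |partialD i f x₀| ≤ C * (B / r + r * A) := by
  set c := ∫ y, radialDensity y with hc
  have hcpos : 0 < c := integral_radialDensity_pos
  set D : ℝ := ∑ i, ((∫ y, |partialD i radialBump y|) + ∫ y, |partialD i radialDensity y|) with hD
  have hnn : ∀ i, 0 ≤ (∫ y, |partialD i radialBump y|) + ∫ y, |partialD i radialDensity y| :=
    fun i => add_nonneg (integral_nonneg fun _ => abs_nonneg _)
      (integral_nonneg fun _ => abs_nonneg _)
  have hD0 : 0 ≤ D := Finset.sum_nonneg fun i _ => hnn i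
  refine ⟨D / c, by positivity, fun f hf x₀ r A B hr hB hA i => ?_⟩
  have hA0 : 0 ≤ A := (abs_nonneg _).trans (hA x₀ (mem_closedBall_self hr.le))
  have hB0 : 0 ≤ B := (abs_nonneg _).trans (hB x₀ (mem_closedBall_self hr.le))
  have hDi := Finset.single_le_sum (fun i _ => hnn i) (Finset.mem_univ i)
  rw [← hD] at hDi
  have hDQ : ∫ y, |partialD i radialBump y| ≤ D := by
    have : 0 ≤ ∫ y, |partialD i radialDensity y| := integral_nonneg fun _ => abs_nonneg _
    linarith
  have hDρ : ∫ y, |partialD i radialDensity y| ≤ D := by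
    have : 0 ≤ ∫ y, |partialD i radialBump y| := integral_nonneg fun _ => abs_nonneg _
    linarith
  -- bound for the integral of a product against a function supported in the unit disk
  have hbound : ∀ (g h : E2 → ℝ) (M s : ℝ), ContDiff ℝ ∞ h → HasCompactSupport h →
      (∀ y, 1 < ‖y‖ → h y = 0) → s ∈ Set.Icc 0 r → (∀ x ∈ closedBall x₀ r, |g x| ≤ M) →
      |∫ y, g (x₀ + s • y) * partialD i h y| ≤ M * ∫ y, |partialD i h y| := by
    intro g h M s hh hhc hh0 hs hg
    rw [← integral_const_mul, ← Real.norm_eq_abs]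
    refine norm_integral_le_of_norm_le ?_ (Eventually.of_forall fun y => ?_)
    · exact (((hh.partialD i).continuous.integrable_of_hasCompactSupport
        (hhc.partialD i)).abs).const_mul M
    · rw [norm_mul, Real.norm_eq_abs, Real.norm_eq_abs]
      rcases le_or_gt ‖y‖ 1 with hy | hy
      · exact mul_le_mul_of_nonneg_right (hg _ (add_smul_mem_closedBall hs hy)) (abs_nonneg _)
      · have : partialD i h y = 0 := by
          have h0 : h =ᶠ[𝓝 y] fun _ => 0 := by
            filter_upwards [(isOpen_lt continuous_const continuous_norm).mem_nhds hy] with z hz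
            exact hh0 z hz
          rw [(partialD_congr h0 i).eq_of_nhds]
          simp [partialD]
        simp [this]
  have hparts : ∀ (g h : E2 → ℝ) (s : ℝ), ContDiff ℝ ∞ g → ContDiff ℝ ∞ h → HasCompactSupport h →
      s * ∫ y, partialD i g (x₀ + s • y) * h y = -∫ y, g (x₀ + s • y) * partialD i h y := by
    intro g h s hg hh hhc
    have hg' : ContDiff ℝ ∞ fun y => g (x₀ + s • y) := hg.comp (by fun_prop)
    have h0 := integral_partialD_eq_zero (hg'.mul hh) hhc.mul_left i
    have hI1 : Integrable fun y => s * (partialD i g (x₀ + s • y) * h y) := by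
      have := (hg.partialD i).continuous
      have := hh.continuous
      exact Continuous.integrable_of_hasCompactSupport (by fun_prop) (hhc.mul_left).mul_left
    have hI2 : Integrable fun y => g (x₀ + s • y) * partialD i h y := by
      have := hg'.continuous
      have := (hh.partialD i).continuous
      exact Continuous.integrable_of_hasCompactSupport (by fun_prop) (hhc.partialD i).mul_left
    rw [← integral_const_mul, eq_neg_iff_add_eq_zero, ← integral_add hI1 hI2, ← h0]
    congr 1
    ext y
    rw [partialD_mul hg' hh, partialD_comp_affine hg, smul_eq_mul]
    ring
  have hcomm : laplacian2 (partialD i f) = partialD i (laplacian2 f) := by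
    ext x
    unfold laplacian2
    simp only [Fin.sum_univ_two]
    rw [partialD_add ((hf.partialD 0).partialD 0) ((hf.partialD 1).partialD 1),
      partialD_comm hf 0 i, partialD_comm hf 1 i, partialD_comm (hf.partialD 0) 0 i,
      partialD_comm (hf.partialD 1) 1 i]
  set m : ℝ → ℝ := fun s => ∫ y, partialD i f (x₀ + s • y) * radialDensity y with hm
  have hderiv : ∀ s ∈ Set.Icc 0 r, ‖s * ∫ y, laplacian2 (partialD i f) (x₀ + s • y) *
      radialBump y‖ ≤ A * D := by
    intro s hs
    rw [hcomm, hparts _ _ s hf.laplacian2 contDiff_radialBump hasCompactSupport_radialBump,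
      norm_neg, Real.norm_eq_abs]
    exact (hbound _ _ A s contDiff_radialBump hasCompactSupport_radialBump
      (fun y hy => radialBump_eq_zero hy.le) hs hA).trans (by gcongr)
  have h1 : ‖m r - m 0‖ ≤ A * D * ‖r - 0‖ :=
    (convex_Icc 0 r).norm_image_sub_le_of_norm_hasDerivWithin_le
      (fun s _ => (hasDerivAt_radial_average (hf.partialD i) x₀ s).hasDerivWithinAt) hderiv
      (Set.left_mem_Icc.2 hr.le) (Set.right_mem_Icc.2 hr.le)
  have h2 : |r * m r| ≤ B * D := by
    rw [hm, hparts f _ r hf contDiff_radialDensity hasCompactSupport_radialDensity, abs_neg]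
    exact (hbound _ _ B r contDiff_radialDensity hasCompactSupport_radialDensity
      (fun y hy => radialDensity_eq_zero hy) (Set.right_mem_Icc.2 hr.le) hB).trans (by gcongr)
  have h3 : m 0 = c * partialD i f x₀ := by
    simp [hm, hc, integral_const_mul, mul_comm]
  rw [h3, Real.norm_eq_abs, sub_zero, Real.norm_of_nonneg hr.le] at h1
  rw [abs_mul, abs_of_pos hr] at h2
  have h4 : |m r| ≤ B * D / r := by
    rw [le_div_iff₀ hr, mul_comm]; exact h2
  have h5 : c * |partialD i f x₀| ≤ B * D / r + A * D * r := by
    rw [← abs_of_pos hcpos, ← abs_mul]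
    have := abs_sub_abs_le_abs_sub (c * partialD i f x₀) (m r)
    rw [abs_sub_comm] at this
    linarith
  rw [show D / c * (B / r + r * A) = (B * D / r + A * D * r) / c by ring, le_div_iff₀ hcpos]
  linarith

end MeanValue

section Potential

/-- A smooth convex truncation of the identity on the half line, flat on `(-∞, T]`. -/
lemma exists_convex_truncation {T : ℝ} (hT : 0 ≤ T) : ∃ θ : ℝ → ℝ, ContDiff ℝ ∞ θ ∧
    (∀ t, 0 ≤ deriv θ t) ∧ (∀ t, 0 ≤ deriv (deriv θ) t) ∧ (∀ t ≤ T, deriv θ t = 0) ∧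
    (∀ t, 0 ≤ t → 0 ≤ θ t) ∧ (∀ t, 0 ≤ t → θ t ≤ t) ∧ ∀ t, 0 ≤ t → t - T - 1 ≤ θ t := by
  set g : ℝ → ℝ := fun s => Real.smoothTransition (s - T) with hg
  have hgs : ContDiff ℝ ∞ g := Real.smoothTransition.contDiff.comp (by fun_prop)
  set θ : ℝ → ℝ := fun t => ∫ s in (0 : ℝ)..t, g s with hθ
  have hd : ∀ t, HasDerivAt θ (g t) t := fun t => hgs.continuous.deriv_integral _ 0 t ▸
    (intervalIntegral.differentiable_integral_of_continuous hgs.continuous t).hasDerivAt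
  have hderiv : deriv θ = g := funext fun t => (hd t).deriv
  have hdiff : Differentiable ℝ θ := fun t => (hd t).differentiableAt
  have hg0 : ∀ t, 0 ≤ g t := fun t => Real.smoothTransition.nonneg _
  have hmono : Monotone θ := monotone_of_deriv_nonneg hdiff fun t => by rw [hderiv]; exact hg0 t
  have hθ0 : θ 0 = 0 := by simp [hθ]
  have hpos : ∀ t, 0 ≤ t → 0 ≤ θ t := fun t ht => hθ0 ▸ hmono ht
  have hd2 : ∀ t, HasDerivAt (fun t => t - θ t) (1 - g t) t := fun t =>
    (hasDerivAt_id t).sub (hd t)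
  have hmono2 : Monotone fun t => t - θ t :=
    monotone_of_hasDerivAt_nonneg hd2 fun t => sub_nonneg.2 (Real.smoothTransition.le_one _)
  refine ⟨θ, contDiff_infty_iff_deriv.2 ⟨hdiff, hderiv ▸ hgs⟩, fun t => hderiv ▸ hg0 t,
    fun t => ?_, fun t ht => ?_, hpos, fun t ht => ?_, fun t ht => ?_⟩
  · rw [hderiv]
    have : Monotone g := fun a b hab => Real.smoothTransition.monotone (by linarith)
    exact this.deriv_nonneg
  · rw [hderiv]
    exact Real.smoothTransition.zero_of_nonpos (by linarith)
  · have := hmono2 ht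
    simp only [hθ0] at this
    linarith
  · rcases le_total t (T + 1) with h | h
    · linarith [hpos t ht]
    · have hanti : AntitoneOn (fun t => t - θ t) (Set.Ici (T + 1)) := by
        refine antitoneOn_of_hasDerivWithinAt_nonpos (convex_Ici _)
          (fun s _ => (hd2 s).continuousAt.continuousWithinAt)
          (fun s _ => (hd2 s).hasDerivWithinAt) fun s hs => ?_
        rw [interior_Ici] at hs
        have : g s = 1 := Real.smoothTransition.one_of_one_le (by linarith [Set.mem_Ioi.1 hs])
        linarith
      have h1 := hanti (Set.mem_Ici.2 le_rfl) (Set.mem_Ici.2 h) h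
      simp only at h1
      linarith [hpos (T + 1) (by linarith)]

variable {k : ℕ} {V : Evec k → ℝ}

lemma IsMultiWell.exists_quadratic_growth (hV : IsMultiWell V) : ∃ a > (0 : ℝ), ∃ R > (0 : ℝ),
    (∀ y, R < ‖y‖ → 0 ≤ ⟪y, gradient V y⟫) ∧ ∀ y, a * (‖y‖ ^ 2 - R ^ 2) ≤ V y := by
  obtain ⟨α, hα, R, hR, h⟩ := hV.growth
  refine ⟨α / 2, by positivity, R, hR, fun y hy => le_trans (by positivity) (h y hy), fun y => ?_⟩
  rcases le_or_gt ‖y‖ R with hy | hy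
  · have : ‖y‖ ^ 2 ≤ R ^ 2 := by gcongr
    nlinarith [hV.nonneg y]
  have hy0 : 0 < ‖y‖ := hR.trans hy
  have hVd : Differentiable ℝ V := hV.smooth.differentiable (by simp)
  have hd : ∀ t : ℝ, HasDerivAt (fun t : ℝ => V (t • y) - α / 2 * (‖y‖ ^ 2 * t ^ 2))
      (⟪gradient V (t • y), y⟫ - α * ‖y‖ ^ 2 * t) t := by
    intro t
    have h1 : HasDerivAt (fun t : ℝ => t • y) y t := by
      simpa using (hasDerivAt_id t).smul_const y
    have h2 := (hVd (t • y)).hasGradientAt.hasFDerivAt.comp_hasDerivAt t h1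
    simp only [InnerProductSpace.toDual_apply_apply] at h2
    have h3 := ((hasDerivAt_pow 2 t).const_mul (‖y‖ ^ 2)).const_mul (α / 2)
    refine (h2.sub h3).congr_deriv ?_
    push_cast
    ring
  have hmono : MonotoneOn (fun t : ℝ => V (t • y) - α / 2 * (‖y‖ ^ 2 * t ^ 2))
      (Set.Ici (R / ‖y‖)) := by
    refine monotoneOn_of_hasDerivWithinAt_nonneg (convex_Ici _)
      (fun s _ => (hd s).continuousAt.continuousWithinAt)
      (fun s _ => (hd s).hasDerivWithinAt) fun s hs => ?_
    rw [interior_Ici, Set.mem_Ioi, div_lt_iff₀ hy0] at hs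
    have hs0 : 0 < s := by
      by_contra! hs0
      nlinarith
    have h1 := h (s • y) (by rwa [norm_smul, Real.norm_of_nonneg hs0.le])
    rw [norm_smul, Real.norm_of_nonneg hs0.le, real_inner_smul_left, real_inner_comm] at h1
    have : s * (α * ‖y‖ ^ 2 * s) ≤ s * ⟪gradient V (s • y), y⟫ := by linarith
    linarith [le_of_mul_le_mul_left this hs0]
  have h1 := hmono (Set.mem_Ici.2 le_rfl) (Set.mem_Ici.2 ((div_le_one hy0).2 hy.le))
    ((div_le_one hy0).2 hy.le)
  simp only [one_smul, div_pow, one_pow, mul_one] at h1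
  rw [mul_div_cancel₀ _ (by positivity)] at h1
  linarith [hV.nonneg ((R / ‖y‖) • y)]

lemma IsMultiWell.contDiff_gradient (hV : IsMultiWell V) : ContDiff ℝ ∞ (gradient V) :=
  (InnerProductSpace.toDual ℝ (Evec k)).symm.toContinuousLinearEquiv.contDiff.comp
    (hV.smooth.fderiv_right (m := ∞) (by simp))

lemma IsMultiWell.exists_gradient_bound (hV : IsMultiWell V) (B : ℝ) :
    ∃ C : ℝ, ∀ y, ‖y‖ ≤ B → ‖gradient V y‖ ≤ C := by
  obtain ⟨C, hC⟩ := (isCompact_closedBall (0 : Evec k) B).exists_bound_of_continuousOn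
    hV.contDiff_gradient.continuous.continuousOn
  exact ⟨C, fun y hy => hC y (by simpa using hy)⟩

/-- On bounded sets, the Hessian is coercive up to a multiple of the potential. -/
lemma IsMultiWell.exists_hessian_lower_bound (hV : IsMultiWell V) (B : ℝ) :
    ∃ c > (0 : ℝ), ∃ C ≥ (0 : ℝ), ∀ y, ‖y‖ ≤ B → ∀ w : Evec k,
      c * ‖w‖ ^ 2 ≤ fderiv ℝ (fderiv ℝ V) y w w + C * V y * ‖w‖ ^ 2 := by
  have hV' : Continuous V := hV.smooth.continuous
  have hVd : Continuous (fderiv ℝ (fderiv ℝ V)) :=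
    (hV.smooth.fderiv_right (m := ∞) (by simp)).continuous_fderiv (by simp)
  set K : Set (Evec k × Evec k) := closedBall 0 B ×ˢ sphere 0 1 with hK
  have hKc : IsCompact K := (isCompact_closedBall _ _).prod (isCompact_sphere _ _)
  set F : ℕ → Set (Evec k × Evec k) := fun n =>
    {p | 1 / ((n : ℝ) + 1) < fderiv ℝ (fderiv ℝ V) p.1 p.2 p.2 + n * V p.1} with hF
  have hFo : ∀ n, IsOpen (F n) := fun n => isOpen_lt continuous_const (by fun_prop)
  have hFm : Monotone F := fun m n hmn p hp => by
    have h1 : 1 / ((n : ℝ) + 1) ≤ 1 / ((m : ℝ) + 1) := by gcongr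
    have h2 : (m : ℝ) * V p.1 ≤ n * V p.1 := by
      have := hV.nonneg p.1
      gcongr
    simp only [hF, Set.mem_ofPred_eq] at hp ⊢
    linarith
  have hcov : K ⊆ ⋃ n, F n := by
    rintro ⟨y, w⟩ ⟨-, hw⟩
    have hw0 : w ≠ 0 := fun h => by simp [h] at hw
    rw [Set.mem_iUnion]
    have hlim : Tendsto (fun n : ℕ => 1 / ((n : ℝ) + 1)) atTop (𝓝 0) :=
      tendsto_one_div_add_atTop_nhds_zero_nat
    rcases (hV.nonneg y).eq_or_lt with h0 | h0
    · have h1 := hV.hess_posdef y h0.symm w hw0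
      rw [iteratedFDeriv_two_apply] at h1
      simp only [Matrix.cons_val_zero, Matrix.cons_val_one] at h1
      obtain ⟨n, hn⟩ := (hlim.eventually_lt_const h1).exists
      exact ⟨n, by simpa [hF, ← h0] using hn⟩
    · obtain ⟨n, hn⟩ := exists_nat_gt ((1 - fderiv ℝ (fderiv ℝ V) y w w) / V y)
      refine ⟨n, ?_⟩
      rw [div_lt_iff₀ h0] at hn
      have : 1 / ((n : ℝ) + 1) ≤ 1 := by
        rw [div_le_one (by positivity)]
        linarith [Nat.cast_nonneg (α := ℝ) n]
      simp only [hF, Set.mem_ofPred_eq]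
      linarith
  obtain ⟨n, hn⟩ := hKc.elim_directed_cover F hFo hcov hFm.directed_le
  refine ⟨1 / ((n : ℝ) + 1), by positivity, n, by positivity, fun y hy w => ?_⟩
  rcases eq_or_ne w 0 with rfl | hw
  · simp
  have hw' : 0 < ‖w‖ := norm_pos_iff.2 hw
  have h1 := hn (show (y, ‖w‖⁻¹ • w) ∈ K from
    ⟨by simpa using hy, by simp [norm_smul, hw'.ne']⟩)
  simp only [hF, Set.mem_ofPred_eq, map_smul, smul_apply, smul_eq_mul] at h1
  have h2 := mul_le_mul_of_nonneg_right h1.le (sq_nonneg ‖w‖)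
  refine h2.trans (le_of_eq ?_)
  field_simp

end Potential

section Estimates

variable {k : ℕ} {V : Evec k → ℝ}

lemma laplacian2_comp_inner_self {w : E2 → Evec k} (hw : ContDiff ℝ ∞ w) {θ : ℝ → ℝ}
    (hθ : ContDiff ℝ ∞ θ) (x : E2) :
    laplacian2 (fun y => θ ⟪w y, w y⟫) x =
      deriv (deriv θ) ⟪w x, w x⟫ * ∑ i, (2 * ⟪w x, partialD i w x⟫) ^ 2 +
      deriv θ ⟪w x, w x⟫ * (2 * ∑ i, ‖partialD i w x‖ ^ 2 + 2 * ⟪w x, laplacian2 w x⟫) := by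
  have hθ' : ContDiff ℝ ∞ (deriv θ) := (contDiff_infty_iff_deriv.1 hθ).2
  have hww : ContDiff ℝ ∞ fun y => ⟪w y, w y⟫ := hw.inner ℝ hw
  have hp := fun i => hw.partialD i
  have h1 : ∀ i, (partialD i fun y => θ ⟪w y, w y⟫) =
      fun y => deriv θ ⟪w y, w y⟫ * (2 * ⟪w y, partialD i w y⟫) := fun i => by
    ext y
    rw [partialD_comp_real hww hθ, partialD_inner hw hw,
      real_inner_comm (w y) (partialD i w y)]
    ring
  have h2 : ∀ i, partialD i (partialD i fun y => θ ⟪w y, w y⟫) x =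
      deriv (deriv θ) ⟪w x, w x⟫ * (2 * ⟪w x, partialD i w x⟫) ^ 2 +
      deriv θ ⟪w x, w x⟫ * (2 * ‖partialD i w x‖ ^ 2 + 2 * ⟪w x, partialD i (partialD i w) x⟫) := by
    intro i
    have h3 : ContDiff ℝ ∞ fun y => deriv θ ⟪w y, w y⟫ := hθ'.comp hww
    rw [h1, partialD_mul h3 (contDiff_const.mul (hw.inner ℝ (hp i))),
      partialD_comp_real hww hθ', partialD_const_mul (hw.inner ℝ (hp i)), partialD_inner hw hw,
      partialD_inner hw (hp i), real_inner_comm (w x) (partialD i w x),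
      real_inner_self_eq_norm_sq (partialD i w x)]
    ring
  simp only [laplacian2, h2, Fin.sum_univ_two, inner_add_right]
  ring

lemma laplacian2_comp_inner_self_nonneg {w : E2 → Evec k} (hw : ContDiff ℝ ∞ w) {θ : ℝ → ℝ}
    (hθ : ContDiff ℝ ∞ θ) {R ε : ℝ}
    (hV : ∀ y, R < ‖y‖ → 0 ≤ ⟪y, gradient V y⟫) (h1 : ∀ t, 0 ≤ deriv θ t)
    (h2 : ∀ t, 0 ≤ deriv (deriv θ) t) (h0 : ∀ t ≤ R ^ 2, deriv θ t = 0) {x : E2}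
    (heq : lap w x = (ε ^ 2)⁻¹ • gradient V (w x)) :
    0 ≤ laplacian2 (fun y => θ ⟪w y, w y⟫) x := by
  rw [laplacian2_comp_inner_self hw hθ, ← lap_eq_laplacian2, heq]
  refine add_nonneg (mul_nonneg (h2 _) (Finset.sum_nonneg fun _ _ => sq_nonneg _)) ?_
  rcases le_or_gt ‖w x‖ R with h | h
  · rw [h0 _ (by rw [real_inner_self_eq_norm_sq]; gcongr), zero_mul]
  · refine mul_nonneg (h1 _) ?_
    have := hV _ h
    rw [real_inner_smul_right]
    have h3 : 0 ≤ (ε ^ 2)⁻¹ * ⟪w x, gradient V (w x)⟫ :=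
      mul_nonneg (inv_nonneg.2 (sq_nonneg ε)) this
    have h4 : 0 ≤ ∑ i, ‖partialD i w x‖ ^ 2 := Finset.sum_nonneg fun _ _ => sq_nonneg _
    linarith

lemma integral_comp_affine (g : E2 → ℝ) (x₀ : E2) {r : ℝ} :
    ∫ y, g (x₀ + r • y) = (r ^ 2)⁻¹ * ∫ x, g x := by
  rw [Measure.integral_comp_smul volume (fun y => g (x₀ + y)) r,
    integral_add_left_eq_self (fun y => g y)]
  simp

/-- Interior `L^∞` estimate in terms of the integral of the potential. -/
lemma IsMultiWell.exists_sup_bound (hV : IsMultiWell V) {r : ℝ} (hr : 0 < r) (M : ℝ) :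
    ∃ B : ℝ, ∀ (ε : ℝ) (w : E2 → Evec k) (x₀ : E2), ContDiff ℝ ∞ w →
      (∀ x ∈ closedBall x₀ r, lap w x = (ε ^ 2)⁻¹ • gradient V (w x)) →
      ∫ x in closedBall x₀ r, V (w x) ≤ M → ‖w x₀‖ ≤ B := by
  obtain ⟨a, ha, R, hR, hgrad, hgrowth⟩ := hV.exists_quadratic_growth
  obtain ⟨θ, hθ, hθ1, hθ2, hθ0, hθnn, hθle, hθge⟩ := exists_convex_truncation (sq_nonneg R)
  obtain ⟨S, hS⟩ := contDiff_radialDensity.continuous.bounded_above_of_compact_support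
    hasCompactSupport_radialDensity
  have hS0 : 0 ≤ S := (norm_nonneg _).trans (hS 0)
  set c := ∫ y, radialDensity y with hc
  have hcpos : 0 < c := integral_radialDensity_pos
  set A : ℝ := S * (R ^ 2 * (volume (closedBall (0 : E2) 1)).toReal + a⁻¹ * ((r ^ 2)⁻¹ * M)) with hA
  refine ⟨√(A / c + R ^ 2 + 1), fun ε w x₀ hw heq hM => ?_⟩
  have hf : ContDiff ℝ ∞ fun y => θ ⟪w y, w y⟫ := hθ.comp (hw.inner ℝ hw)
  have h1 := le_radial_average_of_laplacian_nonneg hf x₀ hr.le fun x hx =>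
    laplacian2_comp_inner_self_nonneg hw hθ hgrad hθ1 hθ2 hθ0 (heq x hx)
  set I : E2 → ℝ := (closedBall x₀ r).indicator fun x => V (w x) with hI
  have hVw : Continuous fun x => V (w x) := hV.smooth.continuous.comp hw.continuous
  have hIint : Integrable I := (hVw.continuousOn.integrableOn_compact
    (isCompact_closedBall x₀ r)).integrable_indicator measurableSet_closedBall
  have hI0 : ∀ x, 0 ≤ I x := fun x => Set.indicator_nonneg (fun _ _ => hV.nonneg _) x
  set J : E2 → ℝ := (closedBall (0 : E2) 1).indicator fun _ => (1 : ℝ) with hJ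
  have hJint : Integrable J := (integrableOn_const
    (isCompact_closedBall (0 : E2) 1).measure_lt_top.ne).integrable_indicator
      measurableSet_closedBall
  have hIint' : Integrable fun y => I (x₀ + r • y) :=
    (integrable_comp_smul_iff volume (fun y => I (x₀ + y)) hr.ne').2
      (hIint.comp_add_left x₀)
  have h2 : ∫ y, θ ⟪w (x₀ + r • y), w (x₀ + r • y)⟫ * radialDensity y ≤ A := by
    calc _ ≤ ∫ y, S * (R ^ 2 * J y + a⁻¹ * I (x₀ + r • y)) := by
          refine integral_mono_of_nonneg (Eventually.of_forall fun y => ?_) ?_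
            (Eventually.of_forall fun y => ?_)
          · exact mul_nonneg (hθnn _ real_inner_self_nonneg) (radialDensity_nonneg y)
          · exact ((hJint.const_mul _).add (hIint'.const_mul _)).const_mul _
          · rcases le_or_gt ‖y‖ 1 with hy | hy
            · have e1 : J y = 1 := Set.indicator_of_mem (by simpa using hy) _
              have e2 : I (x₀ + r • y) = V (w (x₀ + r • y)) := Set.indicator_of_mem
                (add_smul_mem_closedBall (Set.right_mem_Icc.2 hr.le) hy) _
              simp only [e1, e2]
              have e3 := hgrowth (w (x₀ + r • y))
              have e4 := hθle ⟪w (x₀ + r • y), w (x₀ + r • y)⟫ real_inner_self_nonneg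
              rw [mul_comm S]
              refine mul_le_mul ?_ ((le_abs_self _).trans (hS y)) (radialDensity_nonneg y) ?_
              · rw [real_inner_self_eq_norm_sq] at e4 ⊢
                refine e4.trans ?_
                have : a⁻¹ * (a * (‖w (x₀ + r • y)‖ ^ 2 - R ^ 2)) ≤
                  a⁻¹ * V (w (x₀ + r • y)) := by gcongr
                rw [inv_mul_cancel_left₀ ha.ne'] at this
                linarith
              · have := hV.nonneg (w (x₀ + r • y))
                positivity
            · simp only [radialDensity_eq_zero hy, mul_zero]
              have := hI0 (x₀ + r • y)
              have : 0 ≤ J y := Set.indicator_nonneg (fun _ _ => zero_le_one) y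
              positivity
      _ = S * (R ^ 2 * (volume (closedBall (0 : E2) 1)).toReal +
            a⁻¹ * ((r ^ 2)⁻¹ * ∫ x in closedBall x₀ r, V (w x))) := by
          rw [integral_const_mul, integral_add (hJint.const_mul _) (hIint'.const_mul _),
            integral_const_mul, integral_const_mul, integral_comp_affine,
            integral_indicator measurableSet_closedBall, integral_indicator measurableSet_closedBall]
          simp [Measure.real]
      _ ≤ A := by
          rw [hA]
          gcongr
  have h3 : θ ⟪w x₀, w x₀⟫ ≤ A / c := by
    rw [le_div_iff₀ hcpos, mul_comm]
    exact h1.trans h2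
  have h4 := hθge ⟪w x₀, w x₀⟫ real_inner_self_nonneg
  rw [real_inner_self_eq_norm_sq] at h3 h4
  exact Real.le_sqrt_of_sq_le (by linarith)

/-- Interior gradient estimate at the natural length scale for bounded solutions. -/
lemma IsMultiWell.exists_gradient_estimate (hV : IsMultiWell V) (B : ℝ) :
    ∃ C : ℝ, 0 ≤ C ∧ ∀ (ε : ℝ) (w : E2 → Evec k) (x₀ : E2), 0 < ε → ContDiff ℝ ∞ w →
      (∀ x ∈ closedBall x₀ ε, lap w x = (ε ^ 2)⁻¹ • gradient V (w x)) →
      (∀ x ∈ closedBall x₀ ε, ‖w x‖ ≤ B) → ∀ i, ‖partialD i w x₀‖ ≤ C / ε := by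
  obtain ⟨C, hC0, hC⟩ := exists_interior_gradient_estimate
  obtain ⟨G, hG⟩ := hV.exists_gradient_bound (max B 0)
  have hG0 : 0 ≤ G := (norm_nonneg _).trans (hG 0 (by simp))
  refine ⟨C * (max B 0 + G), by positivity, fun ε w x₀ hε hw heq hB i => ?_⟩
  rcases eq_or_ne (partialD i w x₀) 0 with h0 | h0
  · rw [h0, norm_zero]
    positivity
  set p := partialD i w x₀ with hp
  set e : Evec k := ‖p‖⁻¹ • p with he
  have hpn : 0 < ‖p‖ := norm_pos_iff.2 h0
  have he1 : ‖e‖ = 1 := by simp [he, norm_smul, hpn.ne']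
  have hpart : ∀ (g : E2 → Evec k), ContDiff ℝ ∞ g → ∀ j,
      (partialD j fun y => ⟪e, g y⟫) = fun y => ⟪e, partialD j g y⟫ := fun g hg j => by
    ext y
    rw [partialD_inner contDiff_const hg]
    simp [partialD]
  have hlap : ∀ x, laplacian2 (fun y => ⟪e, w y⟫) x = ⟪e, laplacian2 w x⟫ := fun x => by
    simp only [laplacian2, hpart w hw, hpart _ (hw.partialD _), inner_sum]
  have hle : ∀ v : Evec k, |⟪e, v⟫| ≤ ‖v‖ := fun v => by
    simpa [he1] using abs_real_inner_le_norm e v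
  have h1 := hC (fun y => ⟪e, w y⟫) (contDiff_const.inner ℝ hw) x₀ ε ((ε ^ 2)⁻¹ * G) (max B 0) hε
    (fun x hx => (hle _).trans ((hB x hx).trans (le_max_left _ _)))
    (fun x hx => by
      rw [hlap, ← lap_eq_laplacian2, heq x hx]
      refine (hle _).trans ?_
      rw [norm_smul, Real.norm_of_nonneg (by positivity)]
      gcongr
      exact hG _ ((hB x hx).trans (le_max_left _ _))) i
  simp only [hpart w hw] at h1
  rw [← hp, he, real_inner_smul_left, real_inner_self_eq_norm_sq] at h1
  have h2 : ‖p‖⁻¹ * ‖p‖ ^ 2 = ‖p‖ := by field_simp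
  rw [h2, abs_of_pos hpn] at h1
  refine h1.trans (le_of_eq ?_)
  field_simp

end Estimates

section IntegralIdentities

variable {k : ℕ} {V : Evec k → ℝ}

lemma IsMultiWell.fderiv_eq_inner_gradient (hV : IsMultiWell V) (y v : Evec k) :
    fderiv ℝ V y v = ⟪gradient V y, v⟫ := by
  rw [((hV.smooth.differentiable (by simp) y).hasGradientAt.hasFDerivAt).fderiv,
    InnerProductSpace.toDual_apply_apply]

lemma IsMultiWell.partialD_potential_comp (hV : IsMultiWell V) {w : E2 → Evec k} (hw : ContDiff ℝ ∞ w)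
    (i : Fin 2) (x : E2) :
    partialD i (fun y => V (w y)) x = ⟪gradient V (w x), partialD i w x⟫ := by
  rw [partialD_comp hw hV.smooth, hV.fderiv_eq_inner_gradient]

lemma contDiff_coord (i : Fin 2) : ContDiff ℝ ∞ fun y : E2 => y i := by fun_prop

lemma partialD_coord (i j : Fin 2) (x : E2) :
    partialD i (fun y : E2 => y j) x = if i = j then 1 else 0 := by
  have h : HasFDerivAt (fun y : E2 => y j) (EuclideanSpace.proj j : E2 →L[ℝ] ℝ) x :=
    (EuclideanSpace.proj j : E2 →L[ℝ] ℝ).hasFDerivAt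
  rw [partialD, h.fderiv]
  simp [b2, eq_comm]

lemma gradSq_eq {w : E2 → Evec k} (x : E2) :
    gradSq w x = ‖partialD 0 w x‖ ^ 2 + ‖partialD 1 w x‖ ^ 2 := by
  simp [gradSq, pder_eq_partialD]

lemma gradSq_nonneg {w : E2 → Evec k} (x : E2) : 0 ≤ gradSq w x :=
  Finset.sum_nonneg fun _ _ => sq_nonneg _

lemma continuous_gradSq {w : E2 → Evec k} (hw : ContDiff ℝ ∞ w) : Continuous (gradSq w) :=
  continuous_finsetSum _ fun i _ => ((hw.partialD i).continuous.norm).pow 2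

lemma IsMultiWell.eDens_nonneg (hV : IsMultiWell V) {ε : ℝ} (hε : 0 < ε) (w : E2 → Evec k)
    (x : E2) : 0 ≤ eDens V ε w x := by
  have h1 := gradSq_nonneg (w := w) x
  have h2 := hV.nonneg (w x)
  unfold eDens
  positivity

lemma IsMultiWell.continuous_eDens (hV : IsMultiWell V) (ε : ℝ) {w : E2 → Evec k}
    (hw : ContDiff ℝ ∞ w) : Continuous (eDens V ε w) :=
  ((continuous_gradSq hw).const_mul _).add ((hV.smooth.continuous.comp hw.continuous).const_mul _)

/-- Conservation of the stress-energy tensor, tested against a cut-off of the dilation field,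
controls the potential energy by the energy on the support of the gradient of the cut-off. -/
lemma IsMultiWell.integral_potential_le (hV : IsMultiWell V) {ε : ℝ} (hε : 0 < ε)
    {w : E2 → Evec k} (hw : ContDiff ℝ ∞ w) {χ : E2 → ℝ} (hχ : ContDiff ℝ ∞ χ)
    (hχc : HasCompactSupport χ)
    (heq : ∀ x ∈ tsupport χ, lap w x = (ε ^ 2)⁻¹ • gradient V (w x))
    {f : E2 → ℝ} (hf : Continuous f) (hfc : HasCompactSupport f) {G : ℝ}
    (hG : ∀ x i j, |partialD j χ x| * |x i| ≤ G * f x) :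
    ∫ x, χ x * (ε⁻¹ * V (w x)) ≤ 2 * G * ∫ x, f x * eDens V ε w x := by
  have hp := hw.partialD 0
  have hq := hw.partialD 1
  set p := partialD 0 w with hpdef
  set q := partialD 1 w with hqdef
  have hVw : ContDiff ℝ ∞ fun x => V (w x) := hV.smooth.comp hw
  have hpp : ContDiff ℝ ∞ fun x => ⟪p x, p x⟫ := hp.inner ℝ hp
  have hqq : ContDiff ℝ ∞ fun x => ⟪q x, q x⟫ := hq.inner ℝ hq
  have hpq : ContDiff ℝ ∞ fun x => ⟪p x, q x⟫ := hp.inner ℝ hq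
  set A : E2 → ℝ := fun x => ε / 2 * (⟪q x, q x⟫ - ⟪p x, p x⟫) + ε⁻¹ * V (w x) with hA
  set D : E2 → ℝ := fun x => ε / 2 * (⟪p x, p x⟫ - ⟪q x, q x⟫) + ε⁻¹ * V (w x) with hD
  set B : E2 → ℝ := fun x => -ε * ⟪p x, q x⟫ with hB
  have hVc : ContDiff ℝ ∞ fun x => ε⁻¹ * V (w x) := contDiff_const.mul hVw
  have hqc : ContDiff ℝ ∞ fun x => ε / 2 * (⟪q x, q x⟫ - ⟪p x, p x⟫) :=
    contDiff_const.mul (hqq.sub hpp)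
  have hpc : ContDiff ℝ ∞ fun x => ε / 2 * (⟪p x, p x⟫ - ⟪q x, q x⟫) :=
    contDiff_const.mul (hpp.sub hqq)
  have hAs : ContDiff ℝ ∞ A := hqc.add hVc
  have hDs : ContDiff ℝ ∞ D := hpc.add hVc
  have hBs : ContDiff ℝ ∞ B := contDiff_const.mul hpq
  have hx := contDiff_coord
  set F : Fin 2 → E2 → ℝ := ![fun x => χ x * (x 0 * A x + x 1 * B x),
    fun x => χ x * (x 0 * B x + x 1 * D x)] with hF
  have hF0 : ContDiff ℝ ∞ fun x : E2 => x 0 * A x + x 1 * B x :=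
    ((hx 0).mul hAs).add ((hx 1).mul hBs)
  have hF1 : ContDiff ℝ ∞ fun x : E2 => x 0 * B x + x 1 * D x :=
    ((hx 0).mul hBs).add ((hx 1).mul hDs)
  have hFs : ∀ i, ContDiff ℝ ∞ (F i) := by
    intro i
    fin_cases i
    · exact hχ.mul hF0
    · exact hχ.mul hF1
  have hFc : ∀ i, HasCompactSupport (F i) := by
    intro i
    fin_cases i
    · exact hχc.mul_right
    · exact hχc.mul_right
  have hcomm : partialD 1 p = partialD 0 q := partialD_comm hw 1 0
  have hdiv : ∀ x, ∑ i, partialD i (F i) x = 2 * (χ x * (ε⁻¹ * V (w x))) +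
      (partialD 0 χ x * (x 0 * A x + x 1 * B x) + partialD 1 χ x * (x 0 * B x + x 1 * D x)) := by
    intro x
    have hA' : partialD 0 A x = ε / 2 * (2 * ⟪q x, partialD 0 q x⟫ - 2 * ⟪p x, partialD 0 p x⟫) +
        ε⁻¹ * ⟪gradient V (w x), p x⟫ := by
      rw [hA, partialD_add hqc hVc, partialD_const_mul (hqq.sub hpp),
        partialD_const_mul hVw, partialD_sub hqq hpp, partialD_inner hq hq,
        partialD_inner hp hp, hV.partialD_potential_comp hw, real_inner_comm (q x) (partialD 0 q x),
        real_inner_comm (p x) (partialD 0 p x)]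
      ring
    have hD' : partialD 1 D x = ε / 2 * (2 * ⟪p x, partialD 1 p x⟫ - 2 * ⟪q x, partialD 1 q x⟫) +
        ε⁻¹ * ⟪gradient V (w x), q x⟫ := by
      rw [hD, partialD_add hpc hVc, partialD_const_mul (hpp.sub hqq),
        partialD_const_mul hVw, partialD_sub hpp hqq, partialD_inner hq hq,
        partialD_inner hp hp, hV.partialD_potential_comp hw, real_inner_comm (q x) (partialD 1 q x),
        real_inner_comm (p x) (partialD 1 p x)]
      ring
    have hB' : ∀ i, partialD i B x = -ε * (⟪p x, partialD i q x⟫ + ⟪q x, partialD i p x⟫) := by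
      intro i
      rw [hB, partialD_const_mul hpq, partialD_inner hp hq, real_inner_comm (q x)]
    have hsum : ∑ i, partialD i (F i) x =
        partialD 0 χ x * (x 0 * A x + x 1 * B x) + partialD 1 χ x * (x 0 * B x + x 1 * D x) +
        χ x * (A x + D x + x 0 * (partialD 0 A x + partialD 1 B x) +
          x 1 * (partialD 0 B x + partialD 1 D x)) := by
      rw [Fin.sum_univ_two]
      change partialD 0 (fun x => χ x * (x 0 * A x + x 1 * B x)) x +
        partialD 1 (fun x => χ x * (x 0 * B x + x 1 * D x)) x = _
      rw [partialD_mul hχ hF0, partialD_mul hχ hF1,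
        partialD_add ((hx 0).mul hAs) ((hx 1).mul hBs),
        partialD_add ((hx 0).mul hBs) ((hx 1).mul hDs),
        partialD_mul (hx 0) hAs, partialD_mul (hx 1) hBs,
        partialD_mul (hx 0) hBs, partialD_mul (hx 1) hDs]
      simp only [partialD_coord]
      simp
      ring
    have hAD : A x + D x = 2 * (ε⁻¹ * V (w x)) := by
      simp only [hA, hD]
      ring
    rw [hsum, hAD]
    by_cases hxs : x ∈ tsupport χ
    · have h := heq x hxs
      rw [lap_eq_laplacian2, laplacian2, Fin.sum_univ_two, ← hpdef, ← hqdef] at h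
      have hz : ∀ v : Evec k, ε⁻¹ * ⟪gradient V (w x), v⟫ =
          ε * (⟪v, partialD 0 p x⟫ + ⟪v, partialD 1 q x⟫) := by
        intro v
        rw [← inner_add_right, h, real_inner_smul_right, real_inner_comm v]
        field_simp
      have h0 : partialD 0 A x + partialD 1 B x = 0 := by
        rw [hA', hB', hz, hcomm]
        ring
      have h1 : partialD 0 B x + partialD 1 D x = 0 := by
        rw [hD', hB', hz, hcomm]
        ring
      rw [h0, h1]
      ring
    · rw [image_eq_zero_of_notMem_tsupport hxs]
      ring
  have hint := integral_div_eq_zero hFs hFc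
  simp only [hdiv] at hint
  have hI1 : Integrable fun x => 2 * (χ x * (ε⁻¹ * V (w x))) := by
    have := hV.smooth.continuous
    have := hw.continuous
    have := hχ.continuous
    exact Continuous.integrable_of_hasCompactSupport (by fun_prop) (hχc.mul_right).mul_left
  set T : E2 → ℝ := fun x =>
    partialD 0 χ x * (x 0 * A x + x 1 * B x) + partialD 1 χ x * (x 0 * B x + x 1 * D x) with hT
  have hI2 : Integrable T := by
    have h0 := (hχ.partialD 0).continuous
    have h1 := (hχ.partialD 1).continuous
    have := hF0.continuous
    have := hF1.continuous
    exact (Continuous.integrable_of_hasCompactSupport (by fun_prop)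
      (hχc.partialD 0).mul_right).add (Continuous.integrable_of_hasCompactSupport (by fun_prop)
      (hχc.partialD 1).mul_right)
  have hcont := hV.continuous_eDens ε hw
  have hI3 : Integrable fun x => 4 * G * (f x * eDens V ε w x) :=
    (Continuous.integrable_of_hasCompactSupport (by fun_prop) hfc.mul_right).const_mul _
  rw [integral_add hI1 hI2, integral_const_mul] at hint
  have hle : ∫ x, -T x ≤ ∫ x, 4 * G * (f x * eDens V ε w x) := by
    refine integral_mono hI2.neg hI3 fun x => ?_
    set e := eDens V ε w x with he
    have he' : e = ε / 2 * (‖p x‖ ^ 2 + ‖q x‖ ^ 2) + ε⁻¹ * V (w x) := by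
      rw [he, eDens, gradSq_eq]
    have he0 : 0 ≤ e := hV.eDens_nonneg hε w x
    have hVx : 0 ≤ ε⁻¹ * V (w x) := mul_nonneg (inv_nonneg.2 hε.le) (hV.nonneg _)
    have hAe : |A x| ≤ e := by
      simp only [hA, real_inner_self_eq_norm_sq]
      rw [abs_le, he']
      constructor <;> nlinarith [mul_nonneg hε.le (sq_nonneg ‖p x‖),
        mul_nonneg hε.le (sq_nonneg ‖q x‖)]
    have hDe : |D x| ≤ e := by
      simp only [hD, real_inner_self_eq_norm_sq]
      rw [abs_le, he']
      constructor <;> nlinarith [mul_nonneg hε.le (sq_nonneg ‖p x‖),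
        mul_nonneg hε.le (sq_nonneg ‖q x‖)]
    have hBe : |B x| ≤ e := by
      simp only [hB]
      rw [abs_mul, abs_neg, abs_of_pos hε, he']
      have h1 := abs_real_inner_le_norm (p x) (q x)
      have h2 : |⟪p x, q x⟫| ≤ (‖p x‖ ^ 2 + ‖q x‖ ^ 2) / 2 := by
        nlinarith [sq_nonneg (‖p x‖ - ‖q x‖)]
      have := mul_le_mul_of_nonneg_left h2 hε.le
      linarith
    have hterm : ∀ (i j : Fin 2) (t : ℝ), |t| ≤ e →
        |partialD j χ x * (x i * t)| ≤ G * f x * e := by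
      intro i j t ht
      rw [abs_mul, abs_mul, ← mul_assoc]
      have := hG x i j
      calc _ ≤ |partialD j χ x| * |x i| * e := by gcongr
        _ ≤ _ := by gcongr
    have t1 := (abs_le.1 (hterm 0 0 _ hAe)).1
    have t2 := (abs_le.1 (hterm 1 0 _ hBe)).1
    have t3 := (abs_le.1 (hterm 0 1 _ hBe)).1
    have t4 := (abs_le.1 (hterm 1 1 _ hDe)).1
    simp only [hT]
    linarith
  rw [integral_neg, integral_const_mul] at hle
  linarith

/-- Testing the equation against a cut-off times `∇V(u)`. -/
lemma IsMultiWell.integral_hessian_le (hV : IsMultiWell V) {ε : ℝ}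
    {w : E2 → Evec k} (hw : ContDiff ℝ ∞ w) {χ : E2 → ℝ} (hχ : ContDiff ℝ ∞ χ)
    (hχc : HasCompactSupport χ) (hχ0 : ∀ x, 0 ≤ χ x)
    (heq : ∀ x ∈ tsupport χ, lap w x = (ε ^ 2)⁻¹ • gradient V (w x)) :
    ∫ x, χ x * ∑ i, fderiv ℝ (fderiv ℝ V) (w x) (partialD i w x) (partialD i w x) ≤
      ∫ x, V (w x) * laplacian2 χ x := by
  have hp := hw.partialD
  have hVw : ContDiff ℝ ∞ fun x => V (w x) := hV.smooth.comp hw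
  have hVw' := hVw.partialD
  have hχ' := hχ.partialD
  have hdV : ContDiff ℝ ∞ (fderiv ℝ V) := hV.smooth.fderiv_right (m := ∞) (by simp)
  have hd2V : Continuous (fderiv ℝ (fderiv ℝ V)) := hdV.continuous_fderiv (by simp)
  have h2 : ∀ i x, partialD i (partialD i fun x => V (w x)) x =
      fderiv ℝ (fderiv ℝ V) (w x) (partialD i w x) (partialD i w x) +
        ⟪gradient V (w x), partialD i (partialD i w) x⟫ := by
    intro i x
    have h1 : (partialD i fun x => V (w x)) = fun y => fderiv ℝ V (w y) (partialD i w y) :=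
      funext fun y => partialD_comp hw hV.smooth i y
    have h3 : ContDiff ℝ ∞ fun y => fderiv ℝ V (w y) := hdV.comp hw
    have h4 : fderiv ℝ (fun y => fderiv ℝ V (w y)) x (b2 i) = _ :=
      partialD_comp hw hdV i x
    rw [h1, partialD, fderiv_clm_apply h3.differentiable_infty.differentiableAt
      (hp i).differentiable_infty.differentiableAt]
    simp only [add_apply, ContinuousLinearMap.comp_apply, ContinuousLinearMap.flip_apply, h4]
    rw [hV.fderiv_eq_inner_gradient, add_comm]
    rfl
  have hdiv : ∀ x, ∑ i, partialD i
      (fun y => χ y * partialD i (fun x => V (w x)) y - V (w y) * partialD i χ y) x =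
      χ x * ∑ i, fderiv ℝ (fderiv ℝ V) (w x) (partialD i w x) (partialD i w x) -
        V (w x) * laplacian2 χ x + χ x * ((ε ^ 2)⁻¹ * ‖gradient V (w x)‖ ^ 2) := by
    intro x
    have h3 : χ x * ⟪gradient V (w x), laplacian2 w x⟫ =
        χ x * ((ε ^ 2)⁻¹ * ‖gradient V (w x)‖ ^ 2) := by
      by_cases hx : x ∈ tsupport χ
      · rw [← lap_eq_laplacian2, heq x hx, real_inner_smul_right, real_inner_self_eq_norm_sq]
      · rw [image_eq_zero_of_notMem_tsupport hx, zero_mul, zero_mul]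
    rw [← h3]
    simp only [partialD_sub (hχ.mul (hVw' _)) (hVw.mul (hχ' _)), partialD_mul hχ (hVw' _),
      partialD_mul hVw (hχ' _), h2, laplacian2, Fin.sum_univ_two, inner_add_right]
    ring
  have hint := integral_div_eq_zero
    (fun i => (hχ.mul (hVw' i)).sub (hVw.mul (hχ' i)))
    (fun i => (hχc.mul_right (f' := partialD i fun x => V (w x))).sub
      ((hχc.partialD i).mul_left (f := fun x => V (w x))))
  simp only [hdiv] at hint
  have hχcont := hχ.continuous
  have hwcont := hw.continuous
  have hI1 : Integrable fun x =>
      χ x * ∑ i, fderiv ℝ (fderiv ℝ V) (w x) (partialD i w x) (partialD i w x) := by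
    have := fun i => (hp i).continuous
    exact Continuous.integrable_of_hasCompactSupport (by fun_prop) hχc.mul_right
  have hLc : HasCompactSupport (laplacian2 χ) :=
    hχc.mono' fun x hx => by_contra fun h => hx (laplacian2_eq_zero_of_notMem_tsupport h)
  have hI2 : Integrable fun x => V (w x) * laplacian2 χ x := by
    have := hV.smooth.continuous
    have := hχ.laplacian2.continuous
    exact Continuous.integrable_of_hasCompactSupport (by fun_prop) hLc.mul_left
  have hI3 : Integrable fun x => χ x * ((ε ^ 2)⁻¹ * ‖gradient V (w x)‖ ^ 2) := by
    have := hV.contDiff_gradient.continuous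
    exact Continuous.integrable_of_hasCompactSupport (by fun_prop) hχc.mul_right
  have hI12 : Integrable fun x =>
      χ x * ∑ i, fderiv ℝ (fderiv ℝ V) (w x) (partialD i w x) (partialD i w x) -
        V (w x) * laplacian2 χ x := hI1.sub hI2
  rw [integral_add hI12 hI3, integral_sub hI1 hI2] at hint
  have h0 : 0 ≤ ∫ x, χ x * ((ε ^ 2)⁻¹ * ‖gradient V (w x)‖ ^ 2) :=
    integral_nonneg fun x => mul_nonneg (hχ0 x) (by positivity)
  linarith

end IntegralIdentities

section CutoffEnergy

variable {k : ℕ} {V : Evec k → ℝ}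

lemma IsMultiWell.exists_integral_gradSq_le (hV : IsMultiWell V) (B : ℝ) :
    ∃ c > 0, ∃ C ≥ 0, ∀ (ε G : ℝ) (w : E2 → Evec k) (χ : E2 → ℝ), 0 < ε → ContDiff ℝ ∞ w →
      ContDiff ℝ ∞ χ → HasCompactSupport χ → (∀ x, 0 ≤ χ x) →
      (∀ x ∈ tsupport χ, lap w x = (ε ^ 2)⁻¹ • gradient V (w x)) →
      (∀ x ∈ tsupport χ, ‖w x‖ ≤ B) → (∀ x ∈ tsupport χ, ∀ i, ‖partialD i w x‖ ≤ G / ε) →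
      c * ∫ x, χ x * (ε * gradSq w x) ≤
        ε * (∫ x, V (w x) * laplacian2 χ x) + 2 * C * G ^ 2 * ∫ x, χ x * (ε⁻¹ * V (w x)) := by
  obtain ⟨c, hc, C, hC, h⟩ := hV.exists_hessian_lower_bound B
  refine ⟨c, hc, C, hC, fun ε G w χ hε hw hχ hχc hχ0 heq hB hG => ?_⟩
  have hVcont := hV.smooth.continuous
  have hwcont := hw.continuous
  have hχcont := hχ.continuous
  have hgcont := continuous_gradSq hw
  have hdV : ContDiff ℝ ∞ (fderiv ℝ V) := hV.smooth.fderiv_right (m := ∞) (by simp)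
  have hd2V : Continuous (fderiv ℝ (fderiv ℝ V)) := hdV.continuous_fderiv (by simp)
  have hp := fun i => (hw.partialD i).continuous
  have hI1 : Integrable fun x => χ x * (ε * gradSq w x) :=
    Continuous.integrable_of_hasCompactSupport (by fun_prop) hχc.mul_right
  have hI2 : Integrable fun x =>
      χ x * ∑ i, fderiv ℝ (fderiv ℝ V) (w x) (partialD i w x) (partialD i w x) :=
    Continuous.integrable_of_hasCompactSupport (by fun_prop) hχc.mul_right
  have hI3 : Integrable fun x => χ x * (ε⁻¹ * V (w x)) :=
    Continuous.integrable_of_hasCompactSupport (by fun_prop) hχc.mul_right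
  have hle : ∫ x, c * (χ x * (ε * gradSq w x)) ≤
      ∫ x, (ε * (χ x * ∑ i, fderiv ℝ (fderiv ℝ V) (w x) (partialD i w x) (partialD i w x)) +
        2 * C * G ^ 2 * (χ x * (ε⁻¹ * V (w x)))) := by
    refine integral_mono (hI1.const_mul _) ((hI2.const_mul _).add (hI3.const_mul _)) fun x => ?_
    by_cases hx : x ∈ tsupport χ
    · have hVx := hV.nonneg (w x)
      have key : ∀ i, c * (ε * ‖partialD i w x‖ ^ 2) ≤
          ε * fderiv ℝ (fderiv ℝ V) (w x) (partialD i w x) (partialD i w x) +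
            C * G ^ 2 * (ε⁻¹ * V (w x)) := by
        intro i
        have h1 := mul_le_mul_of_nonneg_left (h (w x) (hB x hx) (partialD i w x)) hε.le
        have h2 : ‖partialD i w x‖ ^ 2 ≤ (G / ε) ^ 2 :=
          pow_le_pow_left₀ (norm_nonneg _) (hG x hx i) 2
        have h3 : ε * (C * V (w x) * ‖partialD i w x‖ ^ 2) ≤ C * G ^ 2 * (ε⁻¹ * V (w x)) := by
          calc _ ≤ ε * (C * V (w x) * (G / ε) ^ 2) := by gcongr
            _ = _ := by field_simp
        linarith
      have := mul_le_mul_of_nonneg_left (add_le_add (key 0) (key 1)) (hχ0 x)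
      simp only [gradSq_eq, Fin.sum_univ_two]
      linarith
    · simp [image_eq_zero_of_notMem_tsupport hx]
  rw [integral_const_mul, integral_add (hI2.const_mul _) (hI3.const_mul _), integral_const_mul,
    integral_const_mul] at hle
  have := mul_le_mul_of_nonneg_left (hV.integral_hessian_le hw hχ hχc hχ0 heq) hε.le
  linarith

/-- The energy of a solution weighted by a cut-off is controlled by `ε` and by the energy on the
support of the gradient of the cut-off. -/
theorem IsMultiWell.exists_integral_cutoff_energy_le (hV : IsMultiWell V) {N : Set E2}
    (hN : IsCompact N) {r : ℝ} (hr : 0 < r) {χ : E2 → ℝ} (hχ : ContDiff ℝ ∞ χ)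
    (hχ0 : ∀ x, 0 ≤ χ x) (hχN : ∀ x ∈ tsupport χ, closedBall x (2 * r) ⊆ N)
    {f : E2 → ℝ} (hf : Continuous f) (hfc : HasCompactSupport f) {G : ℝ}
    (hG : ∀ x i j, |partialD j χ x| * |x i| ≤ G * f x) (M : ℝ) :
    ∃ a b : ℝ, ∀ (ε : ℝ) (w : E2 → Evec k), 0 < ε → ε ≤ r → ContDiff ℝ ∞ w →
      (∀ x ∈ N, lap w x = (ε ^ 2)⁻¹ • gradient V (w x)) → ∫ x in N, eDens V ε w x ≤ M →
      ∫ x, χ x * eDens V ε w x ≤ a * ε + b * ∫ x, f x * eDens V ε w x := by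
  have hsub : tsupport χ ⊆ N := fun x hx => hχN x hx (mem_closedBall_self (by positivity))
  have hχc : HasCompactSupport χ := hN.of_isClosed_subset (isClosed_tsupport χ) hsub
  obtain ⟨B, hB⟩ := hV.exists_sup_bound hr (r * M)
  obtain ⟨D, hD0, hD⟩ := hV.exists_gradient_estimate B
  obtain ⟨c, hc, C, hC, hK⟩ := hV.exists_integral_gradSq_le B
  obtain ⟨L, hL⟩ := hN.exists_bound_of_continuousOn hχ.laplacian2.continuous.continuousOn
  refine ⟨(2 * c)⁻¹ * (r * (|L| * M)), (2 * c)⁻¹ * (4 * C * D ^ 2 * G) + 2 * G,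
    fun ε w hε hεr hw heq hM => ?_⟩
  have hVcont := hV.smooth.continuous
  have hwcont := hw.continuous
  have hχcont := hχ.continuous
  have hgcont := continuous_gradSq hw
  have hecont := hV.continuous_eDens ε hw
  have hVle : ∀ x, V (w x) ≤ ε * eDens V ε w x := by
    intro x
    have h1 := gradSq_nonneg (w := w) x
    have : ε * eDens V ε w x = ε ^ 2 / 2 * gradSq w x + V (w x) := by
      unfold eDens
      field_simp
    rw [this]
    have : 0 ≤ ε ^ 2 / 2 * gradSq w x := by positivity
    linarith
  have hVN : ∫ x in N, V (w x) ≤ ε * M := by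
    calc ∫ x in N, V (w x) ≤ ∫ x in N, ε * eDens V ε w x :=
          setIntegral_mono ((hVcont.comp hwcont).continuousOn.integrableOn_compact hN)
            ((hecont.const_mul ε).continuousOn.integrableOn_compact hN) hVle
      _ = ε * ∫ x in N, eDens V ε w x := integral_const_mul _ _
      _ ≤ ε * M := by gcongr
  have hM0 : 0 ≤ M := by
    have : 0 ≤ ∫ x in N, V (w x) := integral_nonneg fun x => hV.nonneg _
    exact nonneg_of_mul_nonneg_right (this.trans hVN) hε
  have hbd : ∀ x, closedBall x r ⊆ N → ‖w x‖ ≤ B := by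
    intro x hx
    refine hB ε w x hw (fun y hy => heq y (hx hy)) ?_
    calc _ ≤ ∫ x in N, V (w x) := setIntegral_mono_set
          ((hVcont.comp hwcont).continuousOn.integrableOn_compact hN)
          (ae_of_all _ fun x => hV.nonneg _) hx.eventuallyLE
      _ ≤ ε * M := hVN
      _ ≤ r * M := by gcongr
  have hbd' : ∀ x ∈ tsupport χ, ∀ y ∈ closedBall x r, ‖w y‖ ≤ B := by
    intro x hx y hy
    refine hbd y ((closedBall_subset_closedBall' ?_).trans (hχN x hx))
    rw [mem_closedBall] at hy
    linarith
  have hsubr : ∀ x ∈ tsupport χ, closedBall x ε ⊆ closedBall x r :=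
    fun x _ => closedBall_subset_closedBall hεr
  have hgrad : ∀ x ∈ tsupport χ, ∀ i, ‖partialD i w x‖ ≤ D / ε := fun x hx i =>
    hD ε w x hε hw (fun y hy => heq y (hχN x hx (closedBall_subset_closedBall (by linarith) hy)))
      (fun y hy => hbd' x hx y (hsubr x hx hy)) i
  have hkin := hK ε D w χ hε hw hχ hχc hχ0 (fun x hx => heq x (hsub hx))
    (fun x hx => hbd' x hx x (mem_closedBall_self hr.le)) hgrad
  have hpot := hV.integral_potential_le hε hw hχ hχc (fun x hx => heq x (hsub hx)) hf hfc hG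
  have hlapl : ∫ x, V (w x) * laplacian2 χ x ≤ |L| * (ε * M) := by
    have h0 : ∀ x ∉ N, V (w x) * laplacian2 χ x = 0 := by
      intro x hx
      rw [laplacian2_eq_zero_of_notMem_tsupport fun h => hx (hsub h), mul_zero]
    rw [← setIntegral_eq_integral_of_forall_compl_eq_zero h0]
    calc _ ≤ ∫ x in N, |L| * V (w x) := by
          refine setIntegral_mono_on
            (((hVcont.comp hwcont).mul hχ.laplacian2.continuous).continuousOn.integrableOn_compact
              hN) (((hVcont.comp hwcont).const_mul _).continuousOn.integrableOn_compact hN)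
            hN.measurableSet fun x hx => ?_
          rw [mul_comm]
          exact mul_le_mul_of_nonneg_right
            ((le_abs_self _).trans ((hL x hx).trans (le_abs_self L))) (hV.nonneg _)
      _ = |L| * ∫ x in N, V (w x) := integral_const_mul _ _
      _ ≤ _ := by gcongr
  have hI1 : Integrable fun x => χ x * (ε * gradSq w x) :=
    Continuous.integrable_of_hasCompactSupport (by fun_prop) hχc.mul_right
  have hI3 : Integrable fun x => χ x * (ε⁻¹ * V (w x)) :=
    Continuous.integrable_of_hasCompactSupport (by fun_prop) hχc.mul_right
  have hsplit : ∫ x, χ x * eDens V ε w x =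
      1 / 2 * (∫ x, χ x * (ε * gradSq w x)) + ∫ x, χ x * (ε⁻¹ * V (w x)) := by
    rw [← integral_const_mul, ← integral_add (hI1.const_mul _) hI3]
    congr 1 with x
    unfold eDens
    ring
  rw [hsplit]
  set P := ∫ x, χ x * (ε⁻¹ * V (w x))
  set F := ∫ x, f x * eDens V ε w x
  set K := ∫ x, χ x * (ε * gradSq w x)
  have h1 : ε * (∫ x, V (w x) * laplacian2 χ x) ≤ r * (|L| * M) * ε := by
    calc _ ≤ ε * (|L| * (ε * M)) := by gcongr
      _ ≤ r * (|L| * (ε * M)) := by gcongr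
      _ = _ := by ring
  have h2 : 2 * C * D ^ 2 * P ≤ 2 * C * D ^ 2 * (2 * G * F) := by gcongr
  have h3 : 1 / 2 * K ≤ (2 * c)⁻¹ * (r * (|L| * M) * ε + 4 * C * D ^ 2 * G * F) := by
    rw [inv_mul_eq_div, le_div_iff₀ (by positivity)]
    linarith
  linarith

end CutoffEnergy

section Cutoffs

lemma exists_smooth_cutoff {K U : Set E2} (hK : IsClosed K) (hU : IsOpen U) (hKU : K ⊆ U) :
    ∃ χ : E2 → ℝ, ContDiff ℝ ∞ χ ∧ (∀ᶠ x in 𝓝ˢ K, χ x = 1) ∧ tsupport χ ⊆ U ∧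
      ∀ x, 0 ≤ χ x ∧ χ x ≤ 1 := by
  obtain ⟨χ, h0, h1, h⟩ := exists_contMDiffMap_zero_one_nhds_of_isClosed (n := (⊤ : ℕ∞))
    (modelWithCornersSelf ℝ E2) hU.isClosed_compl hK (Set.disjoint_compl_left_iff_subset.2 hKU)
  refine ⟨χ, contMDiff_iff_contDiff.1 χ.contMDiff, h1, fun x hx => by_contra fun hxU => ?_, h⟩
  exact notMem_tsupport_iff_eventuallyEq.2
    (Filter.Eventually.filter_mono (nhds_le_nhdsSet hxU) h0) hx

/-- A map that is smooth on an open set agrees near a closed subset with a globally smooth map. -/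
lemma exists_contDiff_eventuallyEq_nhdsSet {F : Type*} [NormedAddCommGroup F] [NormedSpace ℝ F]
    {K U : Set E2} (hK : IsClosed K) (hU : IsOpen U) (hKU : K ⊆ U) {u : E2 → F}
    (hu : ContDiffOn ℝ ∞ u U) : ∃ w : E2 → F, ContDiff ℝ ∞ w ∧ w =ᶠ[𝓝ˢ K] u := by
  obtain ⟨χ, hχ, h1, hs, -⟩ := exists_smooth_cutoff hK hU hKU
  refine ⟨fun x => χ x • u x, contDiff_iff_contDiffAt.2 fun x => ?_,
    h1.mono fun x hx => by simp [hx]⟩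
  by_cases hx : x ∈ U
  · exact hχ.contDiffAt.smul (hu.contDiffAt (hU.mem_nhds hx))
  · have h0 : χ =ᶠ[𝓝 x] 0 := notMem_tsupport_iff_eventuallyEq.1 fun h => hx (hs h)
    refine (contDiffAt_const (c := (0 : F))).congr_of_eventuallyEq ?_
    filter_upwards [h0] with y hy
    simp [hy]

lemma lap_eq_of_eventuallyEq {k : ℕ} {u w : E2 → Evec k} {x : E2} (h : w =ᶠ[𝓝 x] u) :
    lap w x = lap u x :=
  Finset.sum_congr rfl fun i _ => (partialD_congr (partialD_congr h i) i).eq_of_nhds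

lemma eDens_eq_of_eventuallyEq {k : ℕ} {V : Evec k → ℝ} {u w : E2 → Evec k} {x : E2} (ε : ℝ)
    (h : w =ᶠ[𝓝 x] u) : eDens V ε w x = eDens V ε u x := by
  simp only [eDens, gradSq, pder_eq_partialD, (partialD_congr h _).eq_of_nhds, h.eq_of_nhds]

end Cutoffs

section Collar

lemma continuous_comp_infDist {g : ℝ → ℝ} (hg : Continuous g) (s : Set E2) :
    Continuous fun x => g (infDist x s) :=
  hg.comp (continuous_infDist_pt s)

lemma isClosed_infDist_le (s : Set E2) (t : ℝ) : IsClosed {x : E2 | infDist x s ≤ t} :=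
  isClosed_le (continuous_infDist_pt s) continuous_const

/-- A function vanishing outside a set where two densities agree has the same weighted
integral. -/
lemma setIntegral_mul_eq_integral_mul {K Ω : Set E2} (hΩ : MeasurableSet Ω) (hK : K ⊆ Ω)
    {f e e' : E2 → ℝ} (hf : ∀ x ∉ K, f x = 0) (he : ∀ x ∈ K, e' x = e x) :
    ∫ x in Ω, f x * e x = ∫ x, f x * e' x := by
  rw [← setIntegral_eq_integral_of_forall_compl_eq_zero (s := Ω) (f := fun x => f x * e' x)
    fun x hx => by rw [hf x fun h => hx (hK h), zero_mul]]
  refine setIntegral_congr_fun hΩ fun x _ => ?_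
  by_cases hx : x ∈ K
  · simp only [he x hx]
  · simp only [hf x hx, zero_mul]

lemma TestFun.of_eq_zero {K Ω : Set E2} (hK : IsCompact K) (hKΩ : K ⊆ Ω) {f : E2 → ℝ}
    (hf : Continuous f) (h0 : ∀ x ∉ K, f x = 0) : TestFun Ω f :=
  ⟨hf, HasCompactSupport.intro hK h0, (closure_minimal (fun x hx => by_contra fun h =>
    Function.mem_support.1 hx (h0 x h)) hK.isClosed).trans hKΩ⟩

/-- A smooth cut-off between two sublevel sets of the distance to a set has a derivative dominated
by any nonnegative function that is at least one between them. -/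
lemma exists_collar_bound {χ f : E2 → ℝ} {s : Set E2} {a b : ℝ} (hχ : ContDiff ℝ ∞ χ)
    (hχc : HasCompactSupport χ) (h1 : ∀ᶠ x in 𝓝ˢ {x : E2 | infDist x s ≤ a}, χ x = 1)
    (hχb : tsupport χ ⊆ {x : E2 | infDist x s < b}) (hf : ∀ x, 0 ≤ f x)
    (hf1 : ∀ x, a ≤ infDist x s → infDist x s ≤ b → 1 ≤ f x) :
    ∃ G, ∀ x i j, |partialD j χ x| * |x i| ≤ G * f x := by
  have hbound : ∀ j i : Fin 2, ∃ D, ∀ x : E2, ‖partialD j χ x * x i‖ ≤ D := fun j i =>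
    (hχc.partialD j).mul_right.exists_bound_of_continuous
      ((hχ.partialD j).continuous.mul (contDiff_coord i).continuous)
  choose D hD using hbound
  have hD0 : ∀ j i, 0 ≤ D j i := fun j i => (norm_nonneg _).trans (hD j i 0)
  refine ⟨∑ j, ∑ i, D j i, fun x i j => ?_⟩
  have hle : D j i ≤ ∑ j, ∑ i, D j i :=
    (Finset.single_le_sum (f := D j) (fun i _ => hD0 j i) (Finset.mem_univ i)).trans
      (Finset.single_le_sum (f := fun j => ∑ i, D j i)
        (fun j _ => Finset.sum_nonneg fun i _ => hD0 j i) (Finset.mem_univ j))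
  have hG0 := (hD0 j i).trans hle
  by_cases h : partialD j χ x = 0
  · rw [h, abs_zero, zero_mul]
    exact mul_nonneg hG0 (hf x)
  have ha : a ≤ infDist x s := by
    by_contra! ha
    have hx : χ =ᶠ[𝓝 x] fun _ => 1 := h1.filter_mono
      (nhds_le_nhdsSet (show x ∈ {x : E2 | infDist x s ≤ a} from ha.le))
    refine h ?_
    rw [(partialD_congr hx j).eq_of_nhds]
    simp [partialD]
  have hb : infDist x s ≤ b :=
    (hχb (by_contra fun hx => h (partialD_eq_zero_of_notMem_tsupport hx j))).le
  calc |partialD j χ x| * |x i| = ‖partialD j χ x * x i‖ := by rw [Real.norm_eq_abs, abs_mul]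
    _ ≤ D j i := hD j i x
    _ ≤ (∑ j, ∑ i, D j i) * 1 := by rwa [mul_one]
    _ ≤ _ := by gcongr; exact hf1 x ha hb

end Collar

/-- clearing-out from a neighborhood of the boundary. If the
limiting energy measure `ν` vanishes on the collar `𝒱_δ = 𝒰_δ \ 𝒰`, then it
vanishes on the closure of `𝒰`. -/
theorem statement_7 (k : ℕ) (hk : 1 ≤ k) (V : Evec k → ℝ) (hV : IsMultiWell V)
    (Ω : Set E2) (hΩo : IsOpen Ω) (hΩb : IsBounded Ω)
    (M₀ : ℝ) (hM₀ : 0 < M₀)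
    (ε : ℕ → ℝ) (u : ℕ → E2 → Evec k)
    (hε : ∀ n, 0 < ε n) (hε0 : Tendsto ε atTop (𝓝 0))
    (hsol : ∀ n, IsSolution V (ε n) Ω (u n))
    (hint : ∀ n, IntegrableOn (eDens V (ε n) (u n)) Ω)
    (hbd : ∀ n, energy V (ε n) (u n) Ω ≤ M₀)
    (ν : Measure E2) (hfin : IsFiniteMeasure ν) (hsupp : ν Ωᶜ = 0)
    (hconv : ∀ f : E2 → ℝ, TestFun Ω f →
      Tendsto (fun n => ∫ x in Ω, f x * eDens V (ε n) (u n) x) atTop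
        (𝓝 (∫ x, f x ∂ν)))
    (𝒰 : Set E2) (h𝒰o : IsOpen 𝒰) (h𝒰Ω : 𝒰 ⊆ Ω)
    (δ : ℝ) (hδ : 0 < δ)
    (hUδ : {x : E2 | infDist x 𝒰 ≤ δ} ⊆ Ω)
    (hnull : ν ({x : E2 | infDist x 𝒰 ≤ δ} \ 𝒰) = 0) :
    ν (closure 𝒰) = 0 := by
  rcases 𝒰.eq_empty_or_nonempty with rfl | hne
  · simp
  set d : E2 → ℝ := fun x => infDist x 𝒰 with hd
  set K : Set E2 := {x | d x ≤ δ} with hKdef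
  have hKcl : IsClosed K := isClosed_infDist_le 𝒰 δ
  have hKc : IsCompact K := Metric.isCompact_of_isClosed_isBounded hKcl (hΩb.subset hUδ)
  have hext : ∀ n, ∃ w : E2 → Evec k, ContDiff ℝ ∞ w ∧ w =ᶠ[𝓝ˢ K] u n := fun n =>
    exists_contDiff_eventuallyEq_nhdsSet hKcl hΩo hUδ (hsol n).1
  choose w hw hwu using hext
  have hwu' : ∀ n, ∀ x ∈ K, w n =ᶠ[𝓝 x] u n := fun n x hx =>
    (hwu n).filter_mono (nhds_le_nhdsSet hx)
  have heK : ∀ n, ∀ x ∈ K, eDens V (ε n) (w n) x = eDens V (ε n) (u n) x := fun n x hx =>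
    eDens_eq_of_eventuallyEq _ (hwu' n x hx)
  have heq : ∀ n, ∀ x ∈ K, lap (w n) x = (ε n ^ 2)⁻¹ • gradient V (w n x) := fun n x hx => by
    rw [lap_eq_of_eventuallyEq (hwu' n x hx), (hsol n).2 x (hUδ hx), (hwu' n x hx).eq_of_nhds]
  have hM : ∀ n, ∫ x in K, eDens V (ε n) (w n) x ≤ M₀ := fun n => by
    rw [setIntegral_congr_fun hKcl.measurableSet (heK n)]
    exact (setIntegral_mono_set (hint n) (ae_of_all _ fun x => hV.eDens_nonneg (hε n) _ x)
      hUδ.eventuallyLE).trans (hbd n)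
  obtain ⟨χ, hχ, hχ1, hχs, hχ01⟩ := exists_smooth_cutoff (isClosed_infDist_le 𝒰 (δ / 3))
    (isOpen_lt (continuous_infDist_pt 𝒰) continuous_const)
    (fun x (hx : infDist x 𝒰 ≤ δ / 3) => show infDist x 𝒰 < 2 * δ / 3 by linarith)
  have hχK : ∀ x ∈ tsupport χ, closedBall x (2 * (δ / 6)) ⊆ K := by
    intro x hx y hy
    have h1 : infDist x 𝒰 < 2 * δ / 3 := hχs hx
    have h2 : infDist y 𝒰 ≤ infDist x 𝒰 + dist y x := infDist_le_infDist_add_dist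
    rw [mem_closedBall] at hy
    show infDist y 𝒰 ≤ δ
    linarith
  have hχc : HasCompactSupport χ := hKc.of_isClosed_subset (isClosed_tsupport χ) fun x hx =>
    hχK x hx (mem_closedBall_self (by positivity))
  set f : E2 → ℝ := fun x => max 0 (min 1 (2 - |d x - δ / 2| * 6 / δ)) with hf
  have hfcont : Continuous f := continuous_comp_infDist
    (g := fun t => max 0 (min 1 (2 - |t - δ / 2| * 6 / δ))) (by fun_prop) 𝒰
  have hf0 : ∀ x, δ / 3 ≤ |d x - δ / 2| → f x = 0 := by
    intro x hx
    refine max_eq_left ((min_le_right _ _).trans ?_)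
    rw [sub_nonpos, le_div_iff₀ hδ]
    linarith
  have hfK : ∀ x ∉ K, f x = 0 := fun x hx => by
    have hx' : δ < d x := not_le.1 hx
    exact hf0 x ((by linarith : δ / 3 ≤ d x - δ / 2).trans (le_abs_self _))
  have hfU : ∀ x ∈ 𝒰, f x = 0 := fun x hx => by
    have hx' : d x = 0 := infDist_zero_of_mem hx
    refine hf0 x ?_
    rw [hx', zero_sub, abs_neg, abs_of_pos (by positivity)]
    linarith
  have hf1 : ∀ x, δ / 3 ≤ infDist x 𝒰 → infDist x 𝒰 ≤ 2 * δ / 3 → 1 ≤ f x := by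
    intro x h1 h2
    have h : |d x - δ / 2| ≤ δ / 6 := abs_le.2 ⟨by simp only [hd]; linarith,
      by simp only [hd]; linarith⟩
    refine le_max_of_le_right (le_min le_rfl ?_)
    rw [le_sub_comm, div_le_iff₀ hδ]
    linarith
  have hfν : ∫ x, f x ∂ν = 0 := by
    refine integral_eq_zero_of_ae ?_
    filter_upwards [measure_eq_zero_iff_ae_notMem.1 hnull] with x hx
    by_contra hfx
    exact hx ⟨by_contra fun h => hfx (hfK x h), fun h => hfx (hfU x h)⟩
  obtain ⟨G, hG⟩ := exists_collar_bound hχ hχc hχ1 hχs (fun x => le_max_left _ _) hf1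
  have hftest := TestFun.of_eq_zero hKc hUδ hfcont hfK
  obtain ⟨a, b, hab⟩ := hV.exists_integral_cutoff_energy_le hKc (by positivity : 0 < δ / 6) hχ
    (fun x => (hχ01 x).1) hχK hfcont hftest.2.1 hG M₀
  set h : E2 → ℝ := fun x => max 0 (1 - d x * 3 / δ) with hh
  have hhcont : Continuous h := continuous_comp_infDist
    (g := fun t => max 0 (1 - t * 3 / δ)) (by fun_prop) 𝒰
  have hh0 : ∀ x, δ / 3 < d x → h x = 0 := fun x hx => by
    refine max_eq_left ?_
    rw [sub_nonpos, le_div_iff₀ hδ]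
    linarith
  have hhK : ∀ x ∉ K, h x = 0 := fun x hx => hh0 x (by
    have hx' : δ < d x := not_le.1 hx
    linarith)
  have hhχ : ∀ x, h x ≤ χ x := by
    intro x
    rcases le_or_gt (d x) (δ / 3) with hx | hx
    · rw [hχ1.self_of_nhdsSet x hx]
      have : 0 ≤ d x := infDist_nonneg
      exact max_le zero_le_one (sub_le_self _ (by positivity))
    · rw [hh0 x hx]
      exact (hχ01 x).1
  have hhtest := TestFun.of_eq_zero hKc hUδ hhcont hhK
  have hhν : ∫ x, h x ∂ν ≤ 0 := by
    have hlim : Tendsto (fun n => a * ε n + b * ∫ x in Ω, f x * eDens V (ε n) (u n) x) atTop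
        (𝓝 0) := by
      simpa [hfν] using (hε0.const_mul a).add ((hconv f hftest).const_mul b)
    refine le_of_tendsto_of_tendsto (hconv h hhtest) hlim ?_
    filter_upwards [hε0.eventually_le_const (by positivity : 0 < δ / 6)] with n hn
    have hecont := hV.continuous_eDens (ε n) (hw n)
    rw [setIntegral_mul_eq_integral_mul hΩo.measurableSet hUδ hhK (heK n),
      setIntegral_mul_eq_integral_mul hΩo.measurableSet hUδ hfK (heK n)]
    refine le_trans (integral_mono ?_ ?_ fun x => ?_)
      (hab (ε n) (w n) (hε n) hn (hw n) (heq n) (hM n))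
    · exact (hhcont.mul hecont).integrable_of_hasCompactSupport hhtest.2.1.mul_right
    · exact (hχ.continuous.mul hecont).integrable_of_hasCompactSupport hχc.mul_right
    · exact mul_le_mul_of_nonneg_right (hhχ x) (hV.eDens_nonneg (hε n) _ x)
  have hhnn : ∀ x, 0 ≤ h x := fun x => le_max_left _ _
  have hhae : h =ᵐ[ν] 0 := (integral_eq_zero_iff_of_nonneg hhnn
    (hhcont.integrable_of_hasCompactSupport hhtest.2.1)).1 (hhν.antisymm (integral_nonneg hhnn))
  refine measure_mono_null (fun x hx => ?_) (ae_iff.1 hhae)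
  have hdx : d x = 0 := (mem_closure_iff_infDist_zero hne).1 hx
  simp [hh, hdx]
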